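/- arXiv:2306.03560 — 3 statements merged into one kernel-verified Lean document; each statement's English description precedes it below -/
import Mathlib

section
/- Let φ be a convex φ-function, let χ be a generalized kernel satisfying condition (χ4) for some fixed 0 < α < 1 with constants M, γ > 0, and let τ be the characteristic function of [0,1] with M_0(τ) := sup_{x∈ℝ} Σ_{k∈ℤ} τ(x−k) < +∞. Then for every f ∈ L^φ_+(ℝ), every λ > 0 and every n ∈ ℕ sufficiently large: I^φ[λ(K_n^χ(f) − f)] ≤ (‖χ‖₁ M_0(τ)/(2‖χ‖_∞))·ω((‖χ‖_∞/a_χ)·4λf, 1/n^α)_φ + (M_0(τ)M/(2‖χ‖_∞))·I^φ[(‖χ‖_∞/a_χ)·8λf]·n^{−γ} + (1/2)·ω((‖χ‖_∞/a_χ)·4λf, 1/n)_φ. -/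
open MeasureTheory

/-- The max-product Kantorovich sampling operator on `Ω = ℝ`:
`K_n^χ(f)(x) = (⨆ k : ℤ, χ(nx-k) · [n ∫_{k/n}^{(k+1)/n} f(t) dt]) / (⨆ k : ℤ, χ(nx-k))`. -/
noncomputable def maxProdKantorovich (χ f : ℝ → ℝ) (n : ℕ) (x : ℝ) : ℝ :=
  (⨆ k : ℤ, χ ((n : ℝ) * x - k) *
      ((n : ℝ) * ∫ t in ((k : ℝ) / n)..(((k : ℝ) + 1) / n), f t)) /
  (⨆ k : ℤ, χ ((n : ℝ) * x - k))

/-- The modular functional `I^φ[f] := ∫_ℝ φ(|f x|) dx` (with values in `[0,∞]`). -/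
noncomputable def modular (φ f : ℝ → ℝ) : ENNReal :=
  ∫⁻ x : ℝ, ENNReal.ofReal (φ |f x|)

/-- The Orlicz-type modulus of smoothness `ω(f,δ)_φ := sup_{|h| ≤ δ} I^φ[f(·+h) − f(·)]`. -/
noncomputable def modSmooth (φ f : ℝ → ℝ) (δ : ℝ) : ENNReal :=
  ⨆ h : {h : ℝ // |h| ≤ δ}, modular φ (fun x => f (x + h) - f x)

/-- `τ`, the characteristic function of `[0,1]`. -/
noncomputable def tauCF : ℝ → ℝ := Set.indicator (Set.Icc (0 : ℝ) 1) fun _ => (1 : ℝ)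

/-- `M₀(τ) := sup_{x ∈ ℝ} Σ_{k ∈ ℤ} τ(x−k)`, the discrete absolute moment of order `0`
of `τ` (finite, since `τ` is bounded with compact support). -/
noncomputable def M0tau : ℝ := ⨆ x : ℝ, ∑' k : ℤ, tauCF (x - k)

lemma one_le_M0tau : 1 ≤ M0tau := by
  have hsum : ∀ x : ℝ, ∑' k : ℤ, tauCF (x - k) =
      ∑ k ∈ Finset.Icc (⌊x⌋ - 1) ⌊x⌋, tauCF (x - k) := by
    intro x
    refine tsum_eq_sum fun k hk => ?_
    refine Set.indicator_of_notMem (fun h => hk ?_) _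
    rw [Set.mem_Icc] at h
    rw [Finset.mem_Icc]
    refine ⟨?_, Int.le_floor.2 (by linarith)⟩
    have h1 : (⌊x⌋ : ℝ) ≤ k + 1 := (Int.floor_le x).trans (by linarith)
    have : ⌊x⌋ ≤ k + 1 := by exact_mod_cast h1
    linarith
  have hle : ∀ y, tauCF y ≤ 1 := fun y => Set.indicator_le_self' (by simp) y |>.trans le_rfl
  have hnn : ∀ y, 0 ≤ tauCF y := fun y => Set.indicator_nonneg (by simp) y
  have hb : BddAbove (Set.range fun x : ℝ => ∑' k : ℤ, tauCF (x - k)) := by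
    refine ⟨2, ?_⟩
    rintro _ ⟨x, rfl⟩
    simp only [hsum]
    refine (Finset.sum_le_card_nsmul _ _ 1 fun k _ => hle _).trans ?_
    simp
  refine le_trans ?_ (le_ciSup hb 0)
  simp only [hsum]
  refine le_trans (le_of_eq ?_)
    (Finset.single_le_sum (f := fun k : ℤ => tauCF ((0 : ℝ) - k)) (fun k _ => hnn _)
      (show (0 : ℤ) ∈ Finset.Icc (⌊(0 : ℝ)⌋ - 1) ⌊(0 : ℝ)⌋ by simp))
  simp [tauCF]

section PhiFunction

variable {φ : ℝ → ℝ}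

lemma continuous_comp_abs (hφcont : ContinuousOn φ (Set.Ici 0)) :
    Continuous fun u : ℝ => φ |u| :=
  hφcont.comp_continuous continuous_abs fun u => abs_nonneg u

lemma ofReal_comp_abs_le (hφmono : MonotoneOn φ (Set.Ici 0)) {u v : ℝ} (h : |u| ≤ |v|) :
    ENNReal.ofReal (φ |u|) ≤ ENNReal.ofReal (φ |v|) :=
  ENNReal.ofReal_le_ofReal (hφmono (abs_nonneg u) (abs_nonneg v) h)

lemma nonneg_of_monotoneOn (hφmono : MonotoneOn φ (Set.Ici 0)) (hφ0 : φ 0 = 0) {u : ℝ}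
    (hu : 0 ≤ u) : 0 ≤ φ u := by
  simpa [hφ0] using hφmono (Set.mem_Ici.2 le_rfl) hu hu

lemma convexOn_comp_abs (hφmono : MonotoneOn φ (Set.Ici 0)) (hφconv : ConvexOn ℝ (Set.Ici 0) φ) :
    ConvexOn ℝ Set.univ fun u : ℝ => φ |u| := by
  refine ⟨convex_univ, fun x _ y _ a b ha hb hab => ?_⟩
  refine le_trans (hφmono (Set.mem_Ici.2 (abs_nonneg _)) ?_ ?_)
    (hφconv.2 (abs_nonneg x) (abs_nonneg y) ha hb hab)
  · exact Set.mem_Ici.2 (by simp only [smul_eq_mul]; positivity)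
  · refine (abs_add_le _ _).trans (le_of_eq ?_)
    simp [abs_mul, abs_of_nonneg ha, abs_of_nonneg hb]

lemma ofReal_comp_abs_add_le (hφmono : MonotoneOn φ (Set.Ici 0)) (hφ0 : φ 0 = 0)
    (hφconv : ConvexOn ℝ (Set.Ici 0) φ) (u v : ℝ) :
    ENNReal.ofReal (φ |u + v|) ≤
      (ENNReal.ofReal (φ |2 * u|) + ENNReal.ofReal (φ |2 * v|)) / 2 := by
  have h := (convexOn_comp_abs hφmono hφconv).2 (Set.mem_univ (2 * u)) (Set.mem_univ (2 * v))
    (by norm_num : (0 : ℝ) ≤ 1 / 2) (by norm_num : (0 : ℝ) ≤ 1 / 2) (by norm_num)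
  have e : (1 / 2 : ℝ) • (2 * u) + (1 / 2 : ℝ) • (2 * v) = u + v := by
    simp only [smul_eq_mul]; ring
  rw [e] at h
  rw [← ENNReal.ofReal_add (nonneg_of_monotoneOn hφmono hφ0 (abs_nonneg _))
    (nonneg_of_monotoneOn hφmono hφ0 (abs_nonneg _))]
  have e2 : (2 : ENNReal) = ENNReal.ofReal 2 := by simp
  rw [e2, ← ENNReal.ofReal_div_of_pos (by norm_num)]
  refine ENNReal.ofReal_le_ofReal (h.trans (le_of_eq ?_))
  simp only [smul_eq_mul]; ring

lemma ofReal_comp_abs_mul_le (hφmono : MonotoneOn φ (Set.Ici 0)) (hφ0 : φ 0 = 0)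
    (hφconv : ConvexOn ℝ (Set.Ici 0) φ) {t : ℝ} (ht0 : 0 ≤ t) (ht1 : t ≤ 1) (u : ℝ) :
    ENNReal.ofReal (φ |t * u|) ≤ ENNReal.ofReal t * ENNReal.ofReal (φ |u|) := by
  have h := (convexOn_comp_abs hφmono hφconv).2 (Set.mem_univ u) (Set.mem_univ 0)
    ht0 (sub_nonneg.2 ht1) (by ring)
  rw [← ENNReal.ofReal_mul ht0]
  exact ENNReal.ofReal_le_ofReal (by simpa [hφ0] using h)

lemma ofReal_comp_abs_average_le (hφmono : MonotoneOn φ (Set.Ici 0))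
    (hφcont : ContinuousOn φ (Set.Ici 0)) (hφ0 : φ 0 = 0)
    (hφconv : ConvexOn ℝ (Set.Ici 0) φ) {δ : ℝ} (hδ : 0 < δ) {h : ℝ → ℝ}
    (hh : IntegrableOn h (Set.Ioc 0 δ)) :
    ENNReal.ofReal (φ |δ⁻¹ * ∫ u in (0 : ℝ)..δ, h u|) ≤
      ENNReal.ofReal δ⁻¹ * ∫⁻ u in Set.Ioc 0 δ, ENNReal.ofReal (φ |h u|) := by
  have hnn : ∀ u, 0 ≤ φ |h u| := fun u => nonneg_of_monotoneOn hφmono hφ0 (abs_nonneg _)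
  have hmeas : AEStronglyMeasurable (fun u => φ |h u|) (volume.restrict (Set.Ioc 0 δ)) :=
    (continuous_comp_abs hφcont).comp_aestronglyMeasurable hh.aestronglyMeasurable
  by_cases htop : ∫⁻ u in Set.Ioc 0 δ, ENNReal.ofReal (φ |h u|) = ⊤
  · rw [htop, ENNReal.mul_top (by simpa using hδ)]
    exact le_top
  have hint : IntegrableOn (fun u => φ |h u|) (Set.Ioc 0 δ) := by
    refine ⟨hmeas, ?_⟩
    rw [hasFiniteIntegral_iff_ofReal (Filter.Eventually.of_forall hnn)]
    exact lt_top_iff_ne_top.2 htop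
  have key := (convexOn_comp_abs hφmono hφconv).map_set_average_le
    (continuous_comp_abs hφcont).continuousOn isClosed_univ (t := Set.Ioc 0 δ) (μ := volume)
    (by simpa using hδ) (by simp) (Filter.Eventually.of_forall fun _ => Set.mem_univ _) hh hint
  rw [setAverage_eq, setAverage_eq] at key
  simp only [smul_eq_mul, measureReal_def, Real.volume_Ioc, sub_zero,
    ENNReal.toReal_ofReal hδ.le] at key
  rw [intervalIntegral.integral_of_le hδ.le]
  rw [← ofReal_integral_eq_lintegral_ofReal hint (Filter.Eventually.of_forall hnn),
    ← ENNReal.ofReal_mul (by positivity)]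
  exact ENNReal.ofReal_le_ofReal key

lemma ofReal_comp_abs_iSup_le (hφmono : MonotoneOn φ (Set.Ici 0))
    (hφcont : ContinuousOn φ (Set.Ici 0)) {ι : Type*} [Nonempty ι] {d : ι → ℝ}
    (hd : ∀ i, 0 ≤ d i) (hb : BddAbove (Set.range d)) :
    ENNReal.ofReal (φ |⨆ i, d i|) ≤ ⨆ i, ENNReal.ofReal (φ |d i|) := by
  have hmono : Monotone fun u : ℝ => ENNReal.ofReal (φ (max u 0)) := fun u v huv =>
    ENNReal.ofReal_le_ofReal (hφmono (Set.mem_Ici.2 (le_max_right _ _)) (Set.mem_Ici.2 (le_max_right _ _))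
      (max_le_max huv le_rfl))
  have hcont : Continuous fun u : ℝ => ENNReal.ofReal (φ (max u 0)) :=
    ENNReal.continuous_ofReal.comp
      (hφcont.comp_continuous (by fun_prop) fun u => Set.mem_Ici.2 (le_max_right _ _))
  have h := hmono.map_ciSup_of_continuousAt hcont.continuousAt hb
  have hs : 0 ≤ ⨆ i, d i := Real.iSup_nonneg hd
  simp only [max_eq_left hs, max_eq_left (hd _)] at h
  simp only [abs_of_nonneg hs, abs_of_nonneg (hd _), h, le_refl]

lemma exists_bound_integral_translate (hφmono : MonotoneOn φ (Set.Ici 0))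
    (hφcont : ContinuousOn φ (Set.Ici 0)) (hφ0 : φ 0 = 0) (hφpos : ∀ u : ℝ, 0 < u → 0 < φ u)
    (hφconv : ConvexOn ℝ (Set.Ici 0) φ) {f : ℝ → ℝ} (hfmeas : Measurable f)
    (hfnn : ∀ x, 0 ≤ f x) (hfφ : ∃ c : ℝ, 0 < c ∧ modular φ (fun x => c * f x) < ⊤)
    {δ : ℝ} (hδ : 0 < δ) :
    ∃ C : ℝ, ∀ x : ℝ, IntegrableOn (fun u => f (x + u)) (Set.Ioc 0 δ) ∧
      ∫ u in (0 : ℝ)..δ, f (x + u) ≤ C := by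
  obtain ⟨c, hc, hfin⟩ := hfφ
  have h1 := hφpos 1 one_pos
  have hE0 : ∀ x, 0 ≤ φ |c * f x| := fun u => nonneg_of_monotoneOn hφmono hφ0 (abs_nonneg _)
  have hE : Integrable fun x => φ |c * f x| := by
    refine ⟨((continuous_comp_abs hφcont).measurable.comp
      (hfmeas.const_mul c)).aestronglyMeasurable, ?_⟩
    rw [hasFiniteIntegral_iff_ofReal (Filter.Eventually.of_forall hE0)]
    exact hfin
  have hbound : ∀ x, f x ≤ c⁻¹ * (1 + (φ 1)⁻¹ * φ |c * f x|) := by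
    intro x
    rw [le_inv_mul_iff₀ hc]
    have hv : 0 ≤ c * f x := mul_nonneg hc.le (hfnn x)
    rcases le_total (c * f x) 1 with h | h
    · have : 0 ≤ (φ 1)⁻¹ * φ |c * f x| := mul_nonneg (by positivity) (hE0 x)
      linarith
    · have hp : 0 < c * f x := by linarith
      have := hφconv.2 (Set.mem_Ici.2 hv) (Set.mem_Ici.2 le_rfl) (inv_nonneg.2 hv)
        (sub_nonneg.2 (inv_le_one_of_one_le₀ h)) (by ring)
      simp only [smul_eq_mul, mul_zero, add_zero, hφ0] at this
      rw [inv_mul_cancel₀ hp.ne'] at this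
      rw [le_inv_mul_iff₀ hp] at this
      rw [abs_of_nonneg hv]
      have h2 : c * f x ≤ (φ 1)⁻¹ * φ (c * f x) := by
        rw [le_inv_mul_iff₀ h1]; linarith
      linarith
  refine ⟨c⁻¹ * (δ + (φ 1)⁻¹ * ∫ x, φ |c * f x|), fun x => ?_⟩
  have hEx : Integrable fun u => φ |c * f (x + u)| := hE.comp_add_left x
  have hD : IntegrableOn (fun u => c⁻¹ * (1 + (φ 1)⁻¹ * φ |c * f (x + u)|)) (Set.Ioc 0 δ) :=
    (Integrable.add (integrableOn_const (by simp)) (hEx.integrableOn.const_mul _)).const_mul _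
  have hI : IntegrableOn (fun u => f (x + u)) (Set.Ioc 0 δ) := by
    refine Integrable.mono' hD (hfmeas.comp (measurable_const_add x)).aestronglyMeasurable ?_
    refine Filter.Eventually.of_forall fun u => ?_
    rw [Real.norm_of_nonneg (hfnn _)]
    exact hbound _
  refine ⟨hI, ?_⟩
  rw [intervalIntegral.integral_of_le hδ.le]
  refine (integral_mono hI hD fun u => hbound _).trans ?_
  rw [integral_const_mul, integral_add (f := fun _ => (1 : ℝ)) (integrableOn_const (by simp)).integrable
    (hEx.integrableOn.const_mul _), integral_const_mul]
  refine mul_le_mul_of_nonneg_left (add_le_add ?_ ?_) (by positivity)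
  · simp [measureReal_def, hδ.le]
  · refine mul_le_mul_of_nonneg_left ?_ (by positivity)
    refine (setIntegral_le_integral hEx (Filter.Eventually.of_forall fun u => hE0 _)).trans ?_
    exact le_of_eq (integral_add_left_eq_self (fun u => φ |c * f u|) x)

end PhiFunction

lemma lintegral_tsum_translate_le (δ : ℝ) {W : ℝ → ENNReal} (hW : AEMeasurable W)
    {H : ℝ → ℝ → ENNReal} (hH : Measurable (Function.uncurry H)) :
    ∫⁻ x : ℝ, ∑' k : ℤ, W (x - k * δ) * ∫⁻ u in Set.Ioc 0 δ, H (x + u) (k * δ + u) ≤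
      ∫⁻ y : ℝ, W y * ∫⁻ t : ℝ, H (t + y) t := by
  have hWk : ∀ k : ℤ, AEMeasurable fun x => W (x - k * δ) := fun k =>
    hW.comp_quasiMeasurePreserving
      (measurePreserving_sub_right volume ((k : ℝ) * δ)).quasiMeasurePreserving
  have hJ : ∀ k : ℤ, Measurable fun x : ℝ => ∫⁻ u in Set.Ioc 0 δ, H (x + u) (k * δ + u) := by
    intro k
    refine Measurable.lintegral_prod_right' (f := fun p : ℝ × ℝ => H (p.1 + p.2) (k * δ + p.2)) ?_
    exact hH.comp (by fun_prop : Measurable fun p : ℝ × ℝ => (p.1 + p.2, k * δ + p.2))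
  have hL : ∀ k : ℤ, Measurable fun y : ℝ =>
      ∫⁻ t in Set.Ioc (k * δ) (k * δ + δ), H (t + y) t := by
    intro k
    refine Measurable.lintegral_prod_right' (f := fun p : ℝ × ℝ => H (p.2 + p.1) p.2) ?_
    exact hH.comp (by fun_prop : Measurable fun p : ℝ × ℝ => (p.2 + p.1, p.2))
  rw [lintegral_tsum fun k => (hWk k).fun_mul (hJ k).aemeasurable]
  have hk : ∀ k : ℤ, ∫⁻ x : ℝ, W (x - k * δ) * ∫⁻ u in Set.Ioc 0 δ, H (x + u) (k * δ + u) =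
      ∫⁻ y : ℝ, W y * ∫⁻ t in Set.Ioc (k * δ) (k * δ + δ), H (t + y) t := by
    intro k
    rw [← lintegral_add_right_eq_self _ ((k : ℝ) * δ)]
    refine lintegral_congr fun y => ?_
    rw [add_sub_cancel_right]
    congr 1
    rw [← lintegral_indicator measurableSet_Ioc, ← lintegral_indicator measurableSet_Ioc,
      ← lintegral_add_left_eq_self ((Set.Ioc (k * δ) (k * δ + δ)).indicator _) ((k : ℝ) * δ)]
    refine lintegral_congr fun u => ?_
    simp only [Set.indicator, Set.mem_Ioc, lt_add_iff_pos_right, add_le_add_iff_left]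
    have e : y + k * δ + u = k * δ + u + y := by ring
    rw [e]
  simp only [hk]
  rw [← lintegral_tsum fun k => hW.fun_mul (hL k).aemeasurable]
  refine lintegral_mono fun y => ?_
  rw [ENNReal.tsum_mul_left]
  gcongr
  have hd := Set.pairwise_disjoint_Ioc_add_zsmul (0 : ℝ) δ
  rw [← lintegral_iUnion (μ := volume) (s := fun k : ℤ => Set.Ioc (k * δ) (k * δ + δ))
    (fun _ => measurableSet_Ioc) ?_]
  · exact setLIntegral_le_lintegral _ _
  · convert hd using 3 with k
    simp [add_mul]

lemma abs_iSup_mul_div_iSup_sub_le {ι : Type*} [Nonempty ι] {w p : ι → ℝ} {q a S C : ℝ}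
    (ha : 0 < a) (hw : ∀ i, |w i| ≤ S) (haw : a ≤ ⨆ i, w i) (hp0 : ∀ i, 0 ≤ p i)
    (hp : ∀ i, p i ≤ C) (hq0 : 0 ≤ q) (hq : q ≤ C) :
    BddAbove (Set.range fun i => a⁻¹ * (|w i| * |q - p i|)) ∧
      |(⨆ i, w i * p i) / (⨆ i, w i) - q| ≤ ⨆ i, a⁻¹ * (|w i| * |q - p i|) := by
  have hC : 0 ≤ C := hq0.trans hq
  have hS : 0 ≤ S := (abs_nonneg _).trans (hw (Classical.arbitrary ι))
  have hb : BddAbove (Set.range fun i => a⁻¹ * (|w i| * |q - p i|)) := by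
    refine ⟨a⁻¹ * (S * C), ?_⟩
    rintro _ ⟨i, rfl⟩
    have : |q - p i| ≤ C := abs_le.2 ⟨by linarith [hp i], by linarith [hp0 i]⟩
    exact mul_le_mul_of_nonneg_left (mul_le_mul (hw i) this (abs_nonneg _) hS) (by positivity)
  have hwb : BddAbove (Set.range w) := ⟨S, by rintro _ ⟨i, rfl⟩; exact (le_abs_self _).trans (hw i)⟩
  have hAb : BddAbove (Set.range fun i => w i * p i) := by
    refine ⟨S * C, ?_⟩
    rintro _ ⟨i, rfl⟩
    exact mul_le_mul ((le_abs_self _).trans (hw i)) (hp i) (hp0 i) hS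
  refine ⟨hb, ?_⟩
  set s := ⨆ i, a⁻¹ * (|w i| * |q - p i|)
  set D := ⨆ i, w i with hD
  have hDpos : 0 < D := ha.trans_le haw
  have hs0 : 0 ≤ s := Real.iSup_nonneg fun i => by positivity
  have hi : ∀ i, |w i * q - w i * p i| ≤ D * s := by
    intro i
    have h1 : a⁻¹ * (|w i| * |q - p i|) ≤ s := le_ciSup hb i
    rw [inv_mul_le_iff₀ ha] at h1
    rw [← mul_sub, abs_mul]
    exact h1.trans (mul_le_mul_of_nonneg_right haw hs0)
  have h1 : (⨆ i, w i * p i) ≤ D * q + D * s := by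
    refine ciSup_le fun i => ?_
    have h2 : w i * q ≤ D * q := mul_le_mul_of_nonneg_right (le_ciSup hwb i) hq0
    linarith [(abs_le.1 (hi i)).1]
  have h2 : D * q ≤ (⨆ i, w i * p i) + D * s := by
    rw [hD, Real.iSup_mul_of_nonneg hq0]
    refine ciSup_le fun i => ?_
    have h2 : w i * p i ≤ ⨆ i, w i * p i := le_ciSup hAb i
    linarith [(abs_le.1 (hi i)).2]
  rw [abs_le, neg_le_sub_iff_le_add, sub_le_iff_le_add, div_le_iff₀ hDpos, ← sub_le_iff_le_add,
    le_div_iff₀ hDpos]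
  constructor <;> linarith

section Modular

variable {φ : ℝ → ℝ}

lemma modular_translate_sub_le (hφmono : MonotoneOn φ (Set.Ici 0))
    (hφcont : ContinuousOn φ (Set.Ici 0)) (hφ0 : φ 0 = 0)
    (hφconv : ConvexOn ℝ (Set.Ici 0) φ) {F : ℝ → ℝ} (hF : Measurable F) (y : ℝ) :
    modular φ (fun t => F (t + y) - F t) ≤ modular φ (fun t => 2 * F t) := by
  have hm : Measurable fun t => ENNReal.ofReal (φ |2 * F t|) :=
    ((continuous_comp_abs hφcont).measurable.comp (hF.const_mul 2)).ennreal_ofReal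
  calc modular φ (fun t => F (t + y) - F t)
      ≤ ∫⁻ t, (ENNReal.ofReal (φ |2 * F (t + y)|) + ENNReal.ofReal (φ |2 * F t|)) / 2 := by
        refine lintegral_mono fun t => ?_
        have h := ofReal_comp_abs_add_le hφmono hφ0 hφconv (F (t + y)) (-F t)
        rwa [← sub_eq_add_neg, mul_neg, abs_neg] at h
    _ = modular φ (fun t => 2 * F t) := by
        simp only [div_eq_mul_inv]
        rw [lintegral_mul_const' _ _ (by simp), lintegral_add_right _ hm,
          lintegral_add_right_eq_self (fun t => ENNReal.ofReal (φ |2 * F t|)) y,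
          ← div_eq_mul_inv, ENNReal.add_div, ENNReal.add_halves, modular]

lemma lintegral_mul_modular_translate_sub_le (hφmono : MonotoneOn φ (Set.Ici 0))
    (hφcont : ContinuousOn φ (Set.Ici 0)) (hφ0 : φ 0 = 0)
    (hφconv : ConvexOn ℝ (Set.Ici 0) φ) {F : ℝ → ℝ} (hF : Measurable F) (r : ℝ)
    {W : ℝ → ENNReal} (hW : AEMeasurable W) :
    ∫⁻ y, W y * modular φ (fun t => F (t + y) - F t) ≤
      (∫⁻ y, W y) * modSmooth φ F r +
        (∫⁻ y in {y : ℝ | r < |y|}, W y) * modular φ (fun t => 2 * F t) := by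
  have hB : MeasurableSet {y : ℝ | r < |y|} :=
    measurableSet_lt measurable_const continuous_abs.measurable
  rw [← lintegral_add_compl _ hB, add_comm]
  refine add_le_add ?_ ?_
  · rw [← lintegral_mul_const'' _ hW]
    refine (setLIntegral_mono' hB.compl fun y hy => ?_).trans (setLIntegral_le_lintegral _ _)
    refine mul_le_mul_right ?_ _
    exact le_iSup (fun h : {h : ℝ // |h| ≤ r} => modular φ fun x => F (x + h) - F x)
      ⟨y, not_lt.1 hy⟩
  · rw [← lintegral_mul_const'' _ hW.restrict]
    exact lintegral_mono fun y =>
      mul_le_mul_right (modular_translate_sub_le hφmono hφcont hφ0 hφconv hF y) _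

lemma measurable_ofReal_comp_abs_sub (hφcont : ContinuousOn φ (Set.Ici 0)) {F : ℝ → ℝ}
    (hF : Measurable F) :
    Measurable (Function.uncurry fun s t : ℝ => ENNReal.ofReal (φ |F s - F t|)) :=
  ((continuous_comp_abs hφcont).measurable.comp
    ((hF.comp measurable_fst).sub (hF.comp measurable_snd))).ennreal_ofReal

lemma lintegral_average_translate_sub_le (hφcont : ContinuousOn φ (Set.Ici 0)) {F : ℝ → ℝ}
    (hF : Measurable F) {δ : ℝ} (hδ : 0 < δ) :
    ∫⁻ x : ℝ, ENNReal.ofReal δ⁻¹ *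
        ∫⁻ u in Set.Ioc 0 δ, ENNReal.ofReal (φ |F (x + u) - F x|) ≤ modSmooth φ F δ := by
  have hm : Measurable (Function.uncurry fun x u : ℝ => ENNReal.ofReal (φ |F (x + u) - F x|)) :=
    (measurable_ofReal_comp_abs_sub hφcont hF).comp
      (by fun_prop : Measurable fun p : ℝ × ℝ => (p.1 + p.2, p.1))
  rw [lintegral_const_mul' _ _ (by simp), lintegral_lintegral_swap hm.aemeasurable]
  calc ENNReal.ofReal δ⁻¹ * ∫⁻ u in Set.Ioc 0 δ, ∫⁻ x, ENNReal.ofReal (φ |F (x + u) - F x|)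
      ≤ ENNReal.ofReal δ⁻¹ * ∫⁻ _ in Set.Ioc 0 δ, modSmooth φ F δ := by
        refine mul_le_mul_right (setLIntegral_mono' measurableSet_Ioc fun u hu => ?_) _
        exact le_iSup (fun h : {h : ℝ // |h| ≤ δ} => modular φ fun x => F (x + h) - F x)
          ⟨u, (abs_of_pos hu.1).trans_le hu.2⟩
    _ = modSmooth φ F δ := by
        rw [setLIntegral_const, Real.volume_Ioc, sub_zero, mul_comm, mul_assoc,
          ← ENNReal.ofReal_mul hδ.le, mul_inv_cancel₀ hδ.ne', ENNReal.ofReal_one, mul_one]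

end Modular

/-- (Quantitative estimate in Orlicz spaces.) Let `φ` be a convex
φ-function, `χ` a generalized kernel satisfying `(χ4)` for a fixed `0 < α < 1` with
constants `M, γ > 0`. Then for every `f ∈ L^φ_+(ℝ)`, every `λ > 0` and every `n`
sufficiently large:
`I^φ[λ(K_n^χ f − f)] ≤ (‖χ‖₁ M₀(τ)/(2‖χ‖_∞))·ω((‖χ‖_∞/aχ)4λf, 1/n^α)_φ
  + (M₀(τ)M/(2‖χ‖_∞))·I^φ[(‖χ‖_∞/aχ)8λf]·n^{−γ} + (1/2)·ω((‖χ‖_∞/aχ)4λf, 1/n)_φ`. -/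
theorem max_product_kantorovich_quantitative_estimate
    (φ : ℝ → ℝ)
    (hφmono : MonotoneOn φ (Set.Ici 0)) (hφcont : ContinuousOn φ (Set.Ici 0))
    (hφ0 : φ 0 = 0) (hφpos : ∀ u : ℝ, 0 < u → 0 < φ u)
    (hφtop : Filter.Tendsto φ Filter.atTop Filter.atTop)
    (hφconv : ConvexOn ℝ (Set.Ici 0) φ)
    (χ : ℝ → ℝ)
    -- (χ1): `χ ∈ L¹(ℝ)` and `χ` is bounded on `ℝ`
    (hχ1 : Integrable χ) (hχb : ∃ C : ℝ, ∀ x : ℝ, |χ x| ≤ C)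
    -- (χ2): `aχ := inf_{x ∈ [-1/2,1/2]} χ x > 0`
    (aχ : ℝ) (haχ : 0 < aχ) (hinf : sInf (χ '' Set.Icc (-(1/2) : ℝ) (1/2)) = aχ)
    -- (χ3): the generalized absolute moment of some order `β > 0` is finite
    (β : ℝ) (hβ : 0 < β)
    (hmβ : BddAbove
      (Set.range fun p : ℝ × ℤ => |χ (p.1 - p.2)| * |p.1 - (p.2 : ℝ)| ^ β))
    -- (χ4): for the fixed `0 < α < 1` and constants `M, γ > 0`
    (α : ℝ) (hα0 : 0 < α) (hα1 : α < 1)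
    (M γ : ℝ) (hM : 0 < M) (hγ : 0 < γ)
    (hχ4 : ∃ N : ℕ, ∀ n : ℕ, N ≤ n →
      (n : ℝ) * ∫ y in {y : ℝ | 1 / (n : ℝ) ^ α < |y|}, |χ ((n : ℝ) * y)| ≤
        M * (n : ℝ) ^ (-γ))
    -- `f ∈ L^φ_+(ℝ)` and `λ > 0`
    (f : ℝ → ℝ) (hfmeas : Measurable f) (hfnn : ∀ x : ℝ, 0 ≤ f x)
    (hfφ : ∃ c : ℝ, 0 < c ∧ modular φ (fun x => c * f x) < ⊤)
    (lam : ℝ) (hlam : 0 < lam) :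
    ∃ N : ℕ, ∀ n : ℕ, N ≤ n →
      modular φ (fun x => lam * (maxProdKantorovich χ f n x - f x)) ≤
        ENNReal.ofReal ((∫ x : ℝ, |χ x|) * M0tau / (2 * ⨆ x : ℝ, |χ x|)) *
            modSmooth φ (fun x => ((⨆ x : ℝ, |χ x|) / aχ) * (4 * lam) * f x)
              (1 / (n : ℝ) ^ α) +
          ENNReal.ofReal (M0tau * M / (2 * ⨆ x : ℝ, |χ x|)) *
            modular φ (fun x => ((⨆ x : ℝ, |χ x|) / aχ) * (8 * lam) * f x) *
            ENNReal.ofReal ((n : ℝ) ^ (-γ)) +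
          modSmooth φ (fun x => ((⨆ x : ℝ, |χ x|) / aχ) * (4 * lam) * f x)
            (1 / (n : ℝ)) / 2 := by
  set S := ⨆ x : ℝ, |χ x|
  obtain ⟨N, hN⟩ := hχ4
  refine ⟨max N 1, fun n hn => ?_⟩
  have hχ4n := hN n ((le_max_left _ _).trans hn)
  have hn0 : (0 : ℝ) < n := by exact_mod_cast (le_max_right N 1).trans hn
  have hχS : ∀ x, |χ x| ≤ S := fun x =>
    le_ciSup (f := fun x => |χ x|)
      (hχb.imp fun C hC => by rintro _ ⟨x, rfl⟩; exact hC x) x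
  have haχle : ∀ x ∈ Set.Icc (-(1 / 2) : ℝ) (1 / 2), aχ ≤ χ x := by
    intro x hx
    rw [← hinf]
    refine csInf_le ⟨-S, ?_⟩ (Set.mem_image_of_mem χ hx)
    rintro _ ⟨y, -, rfl⟩
    exact (abs_le.1 (hχS y)).1
  have haS : aχ ≤ S := (haχle 0 (by norm_num)).trans ((le_abs_self _).trans (hχS 0))
  have hSpos : 0 < S := haχ.trans_le haS
  set c := S / aχ * (4 * lam) with hc
  have hcpos : 0 < c := by positivity
  have hc2 : 2 * lam ≤ c := by
    have : 1 ≤ S / aχ := (one_le_div haχ).2 haS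
    nlinarith
  set δ : ℝ := 1 / n with hδdef
  have hδ : 0 < δ := by positivity
  have hδinv : δ⁻¹ = n := by simp [hδdef]
  have hnδ : n * δ = 1 := by rw [hδdef]; field_simp
  obtain ⟨C, hC⟩ := exists_bound_integral_translate hφmono hφcont hφ0 hφpos hφconv hfmeas hfnn
    hfφ hδ
  set F : ℝ → ℝ := fun x => c * f x with hFdef
  have hF : Measurable F := hfmeas.const_mul c
  have hnn : ∀ x, 0 ≤ ∫ u in (0 : ℝ)..δ, f (x + u) := fun x =>
    intervalIntegral.integral_nonneg hδ.le fun u _ => hfnn _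
  set avg : ℝ → ℝ := fun x => δ⁻¹ * ∫ u in (0 : ℝ)..δ, f (x + u) with havg
  have havg0 : ∀ x, 0 ≤ avg x := fun x => mul_nonneg (by positivity) (hnn x)
  have havgC : ∀ x, avg x ≤ δ⁻¹ * C := fun x =>
    mul_le_mul_of_nonneg_left (hC x).2 (by positivity)
  have hii : ∀ x, IntervalIntegrable (fun u => f (x + u)) volume 0 δ := fun x =>
    (intervalIntegrable_iff_integrableOn_Ioc_of_le hδ.le).2 (hC x).1
  have hcell : ∀ k : ℤ, (n : ℝ) * ∫ t in ((k : ℝ) / n)..(((k : ℝ) + 1) / n), f t =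
      avg (k * δ) := by
    intro k
    simp only [havg, hδinv]
    rw [intervalIntegral.integral_comp_add_left (fun t => f t)]
    congr 2 <;> rw [hδdef] <;> ring
  have hcomm : ∀ x (k : ℤ), (n : ℝ) * (x - k * δ) = n * x - k := by
    intro x k
    linear_combination (-(k : ℝ)) * hnδ
  set W : ℝ → ENNReal := fun y => ENNReal.ofReal (S⁻¹ * (n * |χ (n * y)|)) with hWdef
  have hχn : Integrable fun y => |χ (n * y)| := (hχ1.comp_mul_left' hn0.ne').abs
  have hWint : Integrable fun y => S⁻¹ * (n * |χ (n * y)|) := (hχn.const_mul _).const_mul _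
  have hW : AEMeasurable W := hWint.aemeasurable.ennreal_ofReal
  have hG := fun u v : ℝ => ofReal_comp_abs_le (u := u) (v := v) hφmono
  have hkernel : ∀ x, ENNReal.ofReal (φ |2 * (lam * (maxProdKantorovich χ f n x - avg x))|) ≤
      ∑' k : ℤ, W (x - k * δ) *
        ∫⁻ u in Set.Ioc 0 δ, ENNReal.ofReal (φ |F (x + u) - F (k * δ + u)|) := by
    intro x
    have haw : aχ ≤ ⨆ k : ℤ, χ (n * x - k) := by
      refine (haχle (n * x - round ((n : ℝ) * x)) ?_).trans
        (le_ciSup (f := fun k : ℤ => χ (n * x - k)) ⟨S, ?_⟩ (round ((n : ℝ) * x)))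
      · exact abs_le.1 (abs_sub_round _)
      · rintro _ ⟨k, rfl⟩
        exact (le_abs_self _).trans (hχS _)
    obtain ⟨hb, hle⟩ := abs_iSup_mul_div_iSup_sub_le (w := fun k : ℤ => χ (n * x - k))
      (p := fun k : ℤ => avg (k * δ)) (q := avg x) haχ (fun k => hχS _) haw
      (fun k => havg0 _) (fun k => havgC _) (havg0 x) (havgC x)
    have hKn : maxProdKantorovich χ f n x =
        (⨆ k : ℤ, χ (n * x - k) * avg (k * δ)) / ⨆ k : ℤ, χ (n * x - k) := by
      simp only [maxProdKantorovich, hcell]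
    rw [← hKn] at hle
    have hb' : BddAbove (Set.range fun k : ℤ =>
        2 * lam * (aχ⁻¹ * (|χ (n * x - k)| * |avg x - avg (k * δ)|))) := by
      obtain ⟨B, hB⟩ := hb
      refine ⟨2 * lam * B, ?_⟩
      rintro _ ⟨k, rfl⟩
      exact mul_le_mul_of_nonneg_left (hB ⟨k, rfl⟩) (by positivity)
    calc ENNReal.ofReal (φ |2 * (lam * (maxProdKantorovich χ f n x - avg x))|)
        ≤ ENNReal.ofReal (φ |⨆ k : ℤ,
            2 * lam * (aχ⁻¹ * (|χ (n * x - k)| * |avg x - avg (k * δ)|))|) := by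
          refine hG _ _ ?_
          rw [← Real.mul_iSup_of_nonneg (by positivity), ← mul_assoc, abs_mul, abs_mul (2 * lam),
            abs_of_pos (by positivity : 0 < 2 * lam)]
          exact mul_le_mul_of_nonneg_left (hle.trans (le_abs_self _)) (by positivity)
      _ ≤ ⨆ k : ℤ, ENNReal.ofReal (φ
            |2 * lam * (aχ⁻¹ * (|χ (n * x - k)| * |avg x - avg (k * δ)|))|) :=
          ofReal_comp_abs_iSup_le hφmono hφcont (fun k => by positivity) hb'
      _ ≤ _ := ?_
    refine iSup_le fun k => le_trans ?_ (ENNReal.le_tsum k)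
    have ht : S⁻¹ * |χ (n * x - k)| ≤ 1 := by
      rw [inv_mul_le_iff₀ hSpos, mul_one]; exact hχS _
    have hav : c * (avg x - avg (k * δ)) =
        δ⁻¹ * ∫ u in (0 : ℝ)..δ, (F (x + u) - F (k * δ + u)) := by
      simp only [hFdef, havg]
      rw [intervalIntegral.integral_sub ((hii _).const_mul c) ((hii _).const_mul c),
        intervalIntegral.integral_const_mul, intervalIntegral.integral_const_mul]
      ring
    calc ENNReal.ofReal (φ |2 * lam * (aχ⁻¹ * (|χ (n * x - k)| * |avg x - avg (k * δ)|))|)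
        ≤ ENNReal.ofReal (φ |(S⁻¹ * |χ (n * x - k)|) * (c * (avg x - avg (k * δ)))|) := by
          refine hG _ _ ?_
          have e : (S⁻¹ * |χ (n * x - k)|) * (c * (avg x - avg (k * δ))) =
              4 * lam * (aχ⁻¹ * (|χ (n * x - k)| * (avg x - avg (k * δ)))) := by
            rw [hc]; field_simp
          rw [e]
          simp only [abs_mul, abs_abs, abs_of_pos hlam, abs_of_pos (inv_pos.2 haχ)]
          gcongr
          norm_num
      _ ≤ ENNReal.ofReal (S⁻¹ * |χ (n * x - k)|) *
            ENNReal.ofReal (φ |c * (avg x - avg (k * δ))|) :=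
          ofReal_comp_abs_mul_le hφmono hφ0 hφconv (by positivity) ht _
      _ ≤ ENNReal.ofReal (S⁻¹ * |χ (n * x - k)|) * (ENNReal.ofReal δ⁻¹ *
            ∫⁻ u in Set.Ioc 0 δ, ENNReal.ofReal (φ |F (x + u) - F (k * δ + u)|)) := by
          refine mul_le_mul_right ?_ _
          rw [hav]
          exact ofReal_comp_abs_average_le hφmono hφcont hφ0 hφconv hδ
            (((hC _).1.const_mul c).sub ((hC _).1.const_mul c))
      _ = _ := by
          rw [← mul_assoc, ← ENNReal.ofReal_mul (by positivity), hδinv]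
          simp only [hWdef, hcomm]
          congr 2
          ring
  have hlocal : ∀ x, ENNReal.ofReal (φ |2 * (lam * (avg x - f x))|) ≤ ENNReal.ofReal δ⁻¹ *
      ∫⁻ u in Set.Ioc 0 δ, ENNReal.ofReal (φ |F (x + u) - F x|) := by
    intro x
    have hav : c * (avg x - f x) = δ⁻¹ * ∫ u in (0 : ℝ)..δ, (F (x + u) - F x) := by
      simp only [hFdef, havg]
      rw [intervalIntegral.integral_sub ((hii _).const_mul c) intervalIntegrable_const,
        intervalIntegral.integral_const_mul, intervalIntegral.integral_const, smul_eq_mul,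
        sub_zero, mul_sub, mul_sub, inv_mul_cancel_left₀ hδ.ne']
      ring
    refine (hG _ (c * (avg x - f x)) ?_).trans ?_
    · rw [← mul_assoc, abs_mul, abs_mul c, abs_of_pos hcpos, abs_of_pos (by positivity)]
      exact mul_le_mul_of_nonneg_right hc2 (abs_nonneg _)
    · rw [hav]
      exact ofReal_comp_abs_average_le hφmono hφcont hφ0 hφconv hδ
        (((hC _).1.const_mul c).sub (integrableOn_const (by simp)))
  have hmeas : Measurable fun x => ENNReal.ofReal δ⁻¹ *
      ∫⁻ u in Set.Ioc 0 δ, ENNReal.ofReal (φ |F (x + u) - F x|) := by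
    refine Measurable.const_mul (Measurable.lintegral_prod_right'
      (f := fun p : ℝ × ℝ => ENNReal.ofReal (φ |F (p.1 + p.2) - F p.1|)) ?_) _
    exact (measurable_ofReal_comp_abs_sub hφcont hF).comp
      (by fun_prop : Measurable fun p : ℝ × ℝ => (p.1 + p.2, p.1))
  have hWtotal : ∫⁻ y, W y = ENNReal.ofReal (S⁻¹ * ∫ x, |χ x|) := by
    rw [hWdef, ← ofReal_integral_eq_lintegral_ofReal hWint
      (Filter.Eventually.of_forall fun y => by positivity), integral_const_mul,
      integral_const_mul, Measure.integral_comp_mul_left (fun y => |χ y|),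
      abs_of_pos (inv_pos.2 hn0), smul_eq_mul, mul_inv_cancel_left₀ hn0.ne']
  have hWtail : ∫⁻ y in {y : ℝ | 1 / (n : ℝ) ^ α < |y|}, W y ≤
      ENNReal.ofReal (S⁻¹ * (M * (n : ℝ) ^ (-γ))) := by
    rw [hWdef, ← ofReal_integral_eq_lintegral_ofReal hWint.restrict
      (Filter.Eventually.of_forall fun y => by positivity), integral_const_mul,
      integral_const_mul]
    exact ENNReal.ofReal_le_ofReal (mul_le_mul_of_nonneg_left hχ4n (by positivity))
  have hhalf : ∀ r : ℝ, ENNReal.ofReal r / 2 = ENNReal.ofReal (r / 2) := fun r => by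
    rw [ENNReal.ofReal_div_of_pos two_pos, ENNReal.ofReal_ofNat]
  have hM0 := one_le_M0tau
  have hF2 : (fun x => S / aχ * (8 * lam) * f x) = fun x => 2 * F x := by
    funext x
    simp only [hFdef, hc]
    ring
  rw [hF2]
  calc modular φ (fun x => lam * (maxProdKantorovich χ f n x - f x))
      ≤ ∫⁻ x, ((∑' k : ℤ, W (x - k * δ) *
            ∫⁻ u in Set.Ioc 0 δ, ENNReal.ofReal (φ |F (x + u) - F (k * δ + u)|)) +
          ENNReal.ofReal δ⁻¹ *
            ∫⁻ u in Set.Ioc 0 δ, ENNReal.ofReal (φ |F (x + u) - F x|)) / 2 := by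
        refine lintegral_mono fun x => ?_
        have e : lam * (maxProdKantorovich χ f n x - f x) =
            lam * (maxProdKantorovich χ f n x - avg x) + lam * (avg x - f x) := by ring
        simp only [e]
        exact (ofReal_comp_abs_add_le hφmono hφ0 hφconv _ _).trans
          (ENNReal.div_le_div_right (add_le_add (hkernel x) (hlocal x)) _)
    _ ≤ ((ENNReal.ofReal (S⁻¹ * ∫ x, |χ x|) * modSmooth φ F (1 / (n : ℝ) ^ α) +
          ENNReal.ofReal (S⁻¹ * (M * (n : ℝ) ^ (-γ))) * modular φ (fun x => 2 * F x)) +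
          modSmooth φ F δ) / 2 := by
        simp only [div_eq_mul_inv _ (2 : ENNReal)]
        rw [lintegral_mul_const' _ _ (by simp), lintegral_add_right _ hmeas]
        refine mul_le_mul_left (add_le_add ?_
          (lintegral_average_translate_sub_le hφcont hF hδ)) _
        refine (lintegral_tsum_translate_le δ hW
          (measurable_ofReal_comp_abs_sub hφcont hF)).trans ?_
        refine (lintegral_mul_modular_translate_sub_le hφmono hφcont hφ0 hφconv hF
          (1 / (n : ℝ) ^ α) hW).trans ?_
        rw [hWtotal]
        exact add_le_add le_rfl (mul_le_mul_left hWtail _)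
    _ ≤ _ := by
        rw [ENNReal.add_div, ENNReal.add_div, ENNReal.mul_div_right_comm,
          ENNReal.mul_div_right_comm, hhalf, hhalf]
        refine add_le_add (add_le_add (mul_le_mul_left (ENNReal.ofReal_le_ofReal ?_) _) ?_) le_rfl
        · have hI : 0 ≤ ∫ x, |χ x| := integral_nonneg fun x => abs_nonneg _
          rw [show S⁻¹ * (∫ x, |χ x|) / 2 = (∫ x, |χ x|) * 1 / (2 * S) by field_simp]
          gcongr
        · rw [mul_right_comm, ← ENNReal.ofReal_mul (by positivity)]
          refine mul_le_mul_left (ENNReal.ofReal_le_ofReal ?_) _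
          rw [show S⁻¹ * (M * (n : ℝ) ^ (-γ)) / 2 = 1 * M / (2 * S) * (n : ℝ) ^ (-γ) by
            field_simp]
          gcongr
end

section
/- Let φ be a convex φ-function, let χ be a generalized kernel satisfying condition (χ4) for some fixed 0 < α < 1 with constants M, γ > 0. Then for any nonnegative f ∈ Lip_φ(v) with 0 < v ≤ 1, there exist K > 0 and λ > 0 such that I^φ[λ(K_n^χ(f) − f)] ≤ K·n^{−ρ} for n ∈ ℕ sufficiently large, where ρ := min{αv, γ}. -/
open MeasureTheory

/-- A continuous convex function on `ℝ`, nondecreasing in `|u|`, vanishing at `0` and not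
identically zero on `[0, 1]`: the even extension of a rescaled convex φ-function. -/
structure IsEvenYoung (ψ : ℝ → ℝ) : Prop where
  convexOn : ConvexOn ℝ Set.univ ψ
  continuous : Continuous ψ
  map_zero : ψ 0 = 0
  mono : ∀ u w : ℝ, |u| ≤ |w| → ψ u ≤ ψ w
  pos_one : 0 < ψ 1

namespace IsEvenYoung

variable {ψ : ℝ → ℝ}

lemma of_abs {φ : ℝ → ℝ} (hmono : MonotoneOn φ (Set.Ici 0)) (hcont : ContinuousOn φ (Set.Ici 0))
    (h0 : φ 0 = 0) (hpos : ∀ u : ℝ, 0 < u → 0 < φ u) (hconv : ConvexOn ℝ (Set.Ici 0) φ)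
    {c : ℝ} (hc : 0 < c) : IsEvenYoung fun u => φ |c * u| where
  convexOn := by
    refine ⟨convex_univ, fun x _ y _ a b ha hb hab => ?_⟩
    have h := hconv.2 (Set.mem_Ici.2 (abs_nonneg (c * x))) (Set.mem_Ici.2 (abs_nonneg (c * y)))
      ha hb hab
    refine le_trans (hmono (Set.mem_Ici.2 (abs_nonneg _)) ?_ ?_) h
    · simp only [smul_eq_mul, Set.mem_Ici]; positivity
    · simp only [smul_eq_mul]
      calc |c * (a * x + b * y)| = |a * (c * x) + b * (c * y)| := by ring_nf
        _ ≤ |a * (c * x)| + |b * (c * y)| := abs_add_le _ _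
        _ = _ := by rw [abs_mul a, abs_mul b, abs_of_nonneg ha, abs_of_nonneg hb]
  continuous := hcont.comp_continuous (by fun_prop) fun x => Set.mem_Ici.2 (abs_nonneg _)
  map_zero := by simp [h0]
  mono := fun u w h => hmono (Set.mem_Ici.2 (abs_nonneg _)) (Set.mem_Ici.2 (abs_nonneg _)) (by
    rw [abs_mul, abs_mul]; gcongr)
  pos_one := hpos _ (by positivity)

lemma nonneg (hψ : IsEvenYoung ψ) (u : ℝ) : 0 ≤ ψ u := by
  simpa [hψ.map_zero] using hψ.mono 0 u (by simp)

lemma map_neg (hψ : IsEvenYoung ψ) (u : ℝ) : ψ (-u) = ψ u :=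
  le_antisymm (hψ.mono _ _ (by simp)) (hψ.mono _ _ (by simp))

lemma measurable_ofReal (hψ : IsEvenYoung ψ) : Measurable fun u => ENNReal.ofReal (ψ u) :=
  hψ.continuous.measurable.ennreal_ofReal

lemma map_mul_le (hψ : IsEvenYoung ψ) {s : ℝ} (hs0 : 0 ≤ s) (hs1 : s ≤ 1) (u : ℝ) :
    ψ (s * u) ≤ s * ψ u := by
  simpa [hψ.map_zero] using hψ.convexOn.2 (Set.mem_univ u) (Set.mem_univ 0) hs0
    (sub_nonneg.2 hs1) (add_sub_cancel s 1)

lemma map_half_add_le (hψ : IsEvenYoung ψ) (u w : ℝ) :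
    ψ (1 / 2 * (u + w)) ≤ 1 / 2 * ψ u + 1 / 2 * ψ w := by
  have := hψ.convexOn.2 (Set.mem_univ u) (Set.mem_univ w) (by norm_num : (0 : ℝ) ≤ 1 / 2)
    (by norm_num : (0 : ℝ) ≤ 1 / 2) (by norm_num)
  simpa [mul_add] using this

lemma abs_le_one_add (hψ : IsEvenYoung ψ) (u : ℝ) : |u| ≤ 1 + ψ u / ψ 1 := by
  have h1 := hψ.pos_one
  rcases le_total |u| 1 with h | h
  · have := div_nonneg (hψ.nonneg u) h1.le
    linarith
  · have hu : 0 < |u| := by linarith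
    have h2 := hψ.map_mul_le (inv_nonneg.2 hu.le) (inv_le_one_of_one_le₀ h) |u|
    rw [inv_mul_cancel₀ hu.ne'] at h2
    have h3 : ψ |u| ≤ ψ u := hψ.mono _ _ (by simp)
    have h4 : |u| ≤ ψ u / ψ 1 := by
      rw [le_div_iff₀ h1]
      calc |u| * ψ 1 ≤ |u| * (|u|⁻¹ * ψ |u|) := by gcongr
        _ = ψ |u| := by field_simp
        _ ≤ _ := h3
    linarith

/-- Jensen's inequality for the mean over `(0, 1/n]`. -/
lemma map_mean_le (hψ : IsEvenYoung ψ) {n : ℕ} (hn : 0 < n) {g : ℝ → ℝ}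
    (hg : IntegrableOn g (Set.Ioc 0 (1 / (n : ℝ)))) :
    ENNReal.ofReal (ψ (n * ∫ t in (0 : ℝ)..1 / n, g t)) ≤
      n * ∫⁻ t in Set.Ioc 0 (1 / (n : ℝ)), ENNReal.ofReal (ψ (g t)) := by
  have hn' : (0 : ℝ) < n := by exact_mod_cast hn
  have hinv : (0 : ℝ) ≤ 1 / n := by positivity
  rcases eq_or_ne (∫⁻ t in Set.Ioc 0 (1 / (n : ℝ)), ENNReal.ofReal (ψ (g t))) ⊤ with h | h
  · rw [h, ENNReal.mul_top (by exact_mod_cast hn.ne')]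
    exact le_top
  have hψg : IntegrableOn (ψ ∘ g) (Set.Ioc 0 (1 / (n : ℝ))) := by
    refine ⟨hψ.continuous.comp_aestronglyMeasurable hg.aestronglyMeasurable, ?_⟩
    refine (hasFiniteIntegral_iff_ofReal (Filter.Eventually.of_forall fun t => hψ.nonneg _)).2 ?_
    exact lt_top_iff_ne_top.2 h
  have hJ := hψ.convexOn.map_set_average_le hψ.continuous.continuousOn isClosed_univ
    (by simp [hn']) (by simp) (by simp) hg hψg
  rw [setAverage_eq, setAverage_eq] at hJ
  simp only [measureReal_def, Real.volume_Ioc, sub_zero, ENNReal.toReal_ofReal hinv] at hJ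
  simp only [one_div, inv_inv, smul_eq_mul] at hJ
  rw [intervalIntegral.integral_of_le hinv, one_div]
  refine (ENNReal.ofReal_le_ofReal hJ).trans ?_
  rw [ENNReal.ofReal_mul hn'.le, ENNReal.ofReal_natCast]
  rw [one_div] at hψg
  gcongr
  exact (ofReal_integral_eq_lintegral_ofReal hψg
    (Filter.Eventually.of_forall fun t => hψ.nonneg _)).le

/-- The value at a point dominated by a supremum is dominated by the sum of the values. -/
lemma ofReal_map_le_tsum (hψ : IsEvenYoung ψ) {ι : Type*} [Nonempty ι] {s : ι → ℝ}
    (hs : BddAbove (Set.range s)) {u : ℝ} (hu : |u| ≤ ⨆ i, s i) :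
    ENNReal.ofReal (ψ u) ≤ ∑' i, ENNReal.ofReal (ψ (s i)) := by
  rcases eq_or_ne (∑' i, ENNReal.ofReal (ψ (s i))) ⊤ with h | h
  · rw [h]; exact le_top
  have hmem : (⨆ i, s i) ∈ closure (Set.range s) := csSup_mem_closure (Set.range_nonempty s) hs
  have hcl : IsClosed {w : ℝ | ENNReal.ofReal (ψ w) ≤ ∑' i, ENNReal.ofReal (ψ (s i))} :=
    isClosed_le (ENNReal.continuous_ofReal.comp hψ.continuous) continuous_const
  have hsub : Set.range s ⊆ {w : ℝ | ENNReal.ofReal (ψ w) ≤ ∑' i, ENNReal.ofReal (ψ (s i))} := by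
    rintro _ ⟨i, rfl⟩
    exact ENNReal.le_tsum i
  refine le_trans (ENNReal.ofReal_le_ofReal (hψ.mono _ _ (hu.trans (le_abs_self _)))) ?_
  exact closure_minimal hsub hcl hmem

lemma integrableOn_of_lintegral_lt_top (hψ : IsEvenYoung ψ) {f : ℝ → ℝ} (hf : Measurable f)
    (hfin : ∫⁻ x, ENNReal.ofReal (ψ (f x)) < ⊤) {s : Set ℝ} (hs : volume s ≠ ⊤) :
    IntegrableOn f s := by
  have h1 : Integrable fun x => ψ (f x) := by
    refine ⟨(hψ.continuous.measurable.comp hf).aestronglyMeasurable, ?_⟩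
    rwa [hasFiniteIntegral_iff_ofReal (Filter.Eventually.of_forall fun t => hψ.nonneg _)]
  have h2 : IntegrableOn (fun x => 1 + ψ (f x) / ψ 1) s :=
    (integrableOn_const hs).add (h1.div_const _).integrableOn
  exact Integrable.mono' h2 hf.aestronglyMeasurable
    (Filter.Eventually.of_forall fun x => hψ.abs_le_one_add _)

end IsEvenYoung

lemma abs_iSup_mul_sub_le {ι : Type*} [Nonempty ι] {c A : ι → ℝ} {C D b : ℝ}
    (hc : ∀ i, |c i| ≤ C) (hA : ∀ i, |A i| ≤ D) (hb : 0 ≤ b) :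
    BddAbove (Set.range fun i => |c i| * |A i - b|) ∧
      |(⨆ i, c i * A i) - (⨆ i, c i) * b| ≤ ⨆ i, |c i| * |A i - b| := by
  have hC : 0 ≤ C := (abs_nonneg _).trans (hc (Classical.arbitrary ι))
  have hB : BddAbove (Set.range fun i => |c i| * |A i - b|) := by
    refine ⟨C * (D + |b|), ?_⟩
    rintro _ ⟨i, rfl⟩
    exact mul_le_mul (hc i) ((abs_sub _ _).trans (by gcongr; exact hA i)) (abs_nonneg _) hC
  have hB1 : BddAbove (Set.range fun i => c i * A i) := by
    refine ⟨C * D, ?_⟩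
    rintro _ ⟨i, rfl⟩
    refine (le_abs_self _).trans ?_
    rw [abs_mul]
    exact mul_le_mul (hc i) (hA i) (abs_nonneg _) hC
  have hB2 : BddAbove (Set.range fun i => c i * b) := by
    refine ⟨C * b, ?_⟩
    rintro _ ⟨i, rfl⟩
    exact mul_le_mul_of_nonneg_right ((le_abs_self _).trans (hc i)) hb
  have key : ∀ i, |c i * A i - c i * b| ≤ ⨆ i, |c i| * |A i - b| := fun i => by
    rw [← mul_sub, abs_mul]
    exact le_ciSup hB i
  refine ⟨hB, ?_⟩
  rw [Real.iSup_mul_of_nonneg hb, abs_sub_le_iff]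
  constructor
  · rw [sub_le_iff_le_add]
    refine ciSup_le fun i => ?_
    have h1 := (abs_sub_le_iff.1 (key i)).1
    have h2 := le_ciSup hB2 i
    linarith
  · rw [sub_le_iff_le_add]
    refine ciSup_le fun i => ?_
    have h1 := (abs_sub_le_iff.1 (key i)).2
    have h2 := le_ciSup hB1 i
    linarith

/-- The forward Steklov mean `n ∫_0^{1/n} f(x + t) dt`. -/
noncomputable def steklovMean (f : ℝ → ℝ) (n : ℕ) (x : ℝ) : ℝ :=
  n * ∫ t in (0 : ℝ)..1 / n, f (x + t)

lemma mul_integral_eq_steklovMean (f : ℝ → ℝ) (n : ℕ) (k : ℤ) :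
    (n : ℝ) * ∫ t in ((k : ℝ) / n)..(((k : ℝ) + 1) / n), f t = steklovMean f n (k / n) := by
  rw [steklovMean, intervalIntegral.integral_comp_add_left, add_zero, add_div]

lemma steklovMean_nonneg {f : ℝ → ℝ} (hf : ∀ x, 0 ≤ f x) (n : ℕ) (x : ℝ) :
    0 ≤ steklovMean f n x :=
  mul_nonneg n.cast_nonneg
    (intervalIntegral.integral_nonneg (by positivity) fun _ _ => hf _)

/-- The modulus `h ↦ ∫ ψ(f(x + h) - f(x)) dx`. -/
noncomputable def shiftModulus (ψ f : ℝ → ℝ) (h : ℝ) : ENNReal :=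
  ∫⁻ x, ENNReal.ofReal (ψ (f (x + h) - f x))

lemma setLIntegral_Ioc_comp_add_left {F : ℝ → ENNReal} (hF : Measurable F) (a b : ℝ) :
    ∫⁻ t in Set.Ioc 0 b, F (a + t) = ∫⁻ t in Set.Ioc a (a + b), F t := by
  rw [← (measurePreserving_add_left volume a).setLIntegral_comp_preimage measurableSet_Ioc hF]
  simp

lemma tsum_setLIntegral_Ioc_le {F : ℝ → ENNReal} (hF : Measurable F) (n : ℕ) :
    ∑' k : ℤ, ∫⁻ t in Set.Ioc 0 (1 / (n : ℝ)), F (k / n + t) ≤ ∫⁻ t, F t := by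
  have h := Set.pairwise_disjoint_Ioc_add_zsmul (0 : ℝ) (1 / (n : ℝ))
  refine le_trans (le_of_eq ?_) (setLIntegral_le_lintegral
    (⋃ k : ℤ, Set.Ioc ((0 : ℝ) + k • (1 / (n : ℝ))) (0 + (k + 1) • (1 / (n : ℝ)))) F)
  rw [lintegral_iUnion (fun _ => measurableSet_Ioc) h]
  refine tsum_congr fun k => ?_
  rw [setLIntegral_Ioc_comp_add_left hF]
  congr 3 <;> simp [div_eq_mul_inv, add_mul]

namespace IsEvenYoung

variable {ψ : ℝ → ℝ}

lemma lintegral_map_sub_shift (hψ : IsEvenYoung ψ) (f : ℝ → ℝ) (h : ℝ) :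
    ∫⁻ x, ENNReal.ofReal (ψ (f x - f (x + h))) = shiftModulus ψ f h := by
  refine lintegral_congr fun x => ?_
  rw [← hψ.map_neg, neg_sub]

lemma integrableOn_comp_add (hψ : IsEvenYoung ψ) {f : ℝ → ℝ} (hf : Measurable f)
    (hfin : ∫⁻ x, ENNReal.ofReal (ψ (f x)) < ⊤) {s : Set ℝ} (hs : volume s ≠ ⊤) (a : ℝ) :
    IntegrableOn (fun t => f (a + t)) s := by
  refine hψ.integrableOn_of_lintegral_lt_top (hf.comp (measurable_const_add a)) ?_ hs
  exact (lintegral_add_left_eq_self (fun x => ENNReal.ofReal (ψ (f x))) a).trans_lt hfin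

lemma abs_steklovMean_le (hψ : IsEvenYoung ψ) {f : ℝ → ℝ} (hf : Measurable f)
    (hfin : ∫⁻ x, ENNReal.ofReal (ψ (f x)) < ⊤) {n : ℕ} (hn : 0 < n) :
    ∃ D, ∀ x, |steklovMean f n x| ≤ D := by
  refine ⟨1 + (n * ∫⁻ x, ENNReal.ofReal (ψ (f x))).toReal / ψ 1, fun x => ?_⟩
  refine (hψ.abs_le_one_add _).trans ?_
  gcongr
  · exact hψ.pos_one.le
  refine (ENNReal.ofReal_le_iff_le_toReal
    (ENNReal.mul_ne_top (ENNReal.natCast_ne_top n) hfin.ne)).1 ?_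
  refine (hψ.map_mean_le hn (hψ.integrableOn_comp_add hf hfin (by simp) x)).trans ?_
  refine mul_le_mul_right ?_ _
  refine (setLIntegral_le_lintegral _ _).trans_eq ?_
  exact lintegral_add_left_eq_self (fun x => ENNReal.ofReal (ψ (f x))) x

lemma map_steklovMean_sub_le (hψ : IsEvenYoung ψ) {f : ℝ → ℝ} (hf : Measurable f)
    (hfin : ∫⁻ x, ENNReal.ofReal (ψ (f x)) < ⊤) {n : ℕ} (hn : 0 < n) (x y : ℝ) :
    ENNReal.ofReal (ψ (steklovMean f n x - steklovMean f n y)) ≤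
      n * ∫⁻ t in Set.Ioc 0 (1 / (n : ℝ)), ENNReal.ofReal (ψ (f (x + t) - f (y + t))) := by
  have h1 := hψ.integrableOn_comp_add hf hfin (s := Set.Ioc 0 (1 / (n : ℝ))) (by simp) x
  have h2 := hψ.integrableOn_comp_add hf hfin (s := Set.Ioc 0 (1 / (n : ℝ))) (by simp) y
  have hinv : (0 : ℝ) ≤ 1 / n := by positivity
  have := hψ.map_mean_le hn (h1.sub h2)
  simp only [Pi.sub_apply] at this
  rwa [intervalIntegral.integral_sub ((intervalIntegrable_iff_integrableOn_Ioc_of_le hinv).2 h1)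
    ((intervalIntegrable_iff_integrableOn_Ioc_of_le hinv).2 h2), mul_sub] at this

lemma map_steklovMean_sub_self_le (hψ : IsEvenYoung ψ) {f : ℝ → ℝ} (hf : Measurable f)
    (hfin : ∫⁻ x, ENNReal.ofReal (ψ (f x)) < ⊤) {n : ℕ} (hn : 0 < n) (x : ℝ) :
    ENNReal.ofReal (ψ (steklovMean f n x - f x)) ≤
      n * ∫⁻ t in Set.Ioc 0 (1 / (n : ℝ)), ENNReal.ofReal (ψ (f (x + t) - f x)) := by
  have h1 := hψ.integrableOn_comp_add hf hfin (s := Set.Ioc 0 (1 / (n : ℝ))) (by simp) x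
  have h2 : IntegrableOn (fun _ : ℝ => f x) (Set.Ioc 0 (1 / (n : ℝ))) :=
    integrableOn_const (by simp)
  have hinv : (0 : ℝ) ≤ 1 / n := by positivity
  have hn' : (n : ℝ) ≠ 0 := by exact_mod_cast hn.ne'
  have := hψ.map_mean_le hn (h1.sub h2)
  simp only [Pi.sub_apply] at this
  rw [intervalIntegral.integral_sub ((intervalIntegrable_iff_integrableOn_Ioc_of_le hinv).2 h1)
    ((intervalIntegrable_iff_integrableOn_Ioc_of_le hinv).2 h2), mul_sub,
    intervalIntegral.integral_const, smul_eq_mul, sub_zero, ← mul_assoc,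
    mul_one_div_cancel hn', one_mul] at this
  exact this

lemma measurable_uncurry_shift (hψ : IsEvenYoung ψ) {f : ℝ → ℝ} (hf : Measurable f) :
    Measurable fun p : ℝ × ℝ => ENNReal.ofReal (ψ (f (p.1 + p.2) - f p.1)) :=
  hψ.measurable_ofReal.comp (by fun_prop)

lemma lintegral_mean_shift_le (hψ : IsEvenYoung ψ) {f : ℝ → ℝ} (hf : Measurable f)
    {n : ℕ} (hn : 0 < n) {E : ENNReal}
    (hE : ∀ h ∈ Set.Ioc 0 (1 / (n : ℝ)), shiftModulus ψ f h ≤ E) :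
    ∫⁻ x, n * ∫⁻ t in Set.Ioc 0 (1 / (n : ℝ)), ENNReal.ofReal (ψ (f (x + t) - f x)) ≤ E := by
  have hn' : (0 : ℝ) < n := by exact_mod_cast hn
  rw [lintegral_const_mul' _ _ (ENNReal.natCast_ne_top n),
    lintegral_lintegral_swap (hψ.measurable_uncurry_shift hf).aemeasurable]
  calc (n : ENNReal) * ∫⁻ t in Set.Ioc 0 (1 / (n : ℝ)), shiftModulus ψ f t
      ≤ n * ∫⁻ _ in Set.Ioc 0 (1 / (n : ℝ)), E := by
        exact mul_le_mul_right (setLIntegral_mono measurable_const hE) _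
    _ = E := by
        rw [setLIntegral_const, Real.volume_Ioc, sub_zero, one_div,
          ENNReal.ofReal_inv_of_pos hn', ENNReal.ofReal_natCast, mul_comm E, ← mul_assoc,
          ENNReal.mul_inv_cancel (by exact_mod_cast hn.ne') (ENNReal.natCast_ne_top n), one_mul]

/-- The sampled differences, weighted by a kernel, are controlled by the modulus averaged against
the rescaled kernel. -/
lemma lintegral_tsum_kernel_le (hψ : IsEvenYoung ψ) {f : ℝ → ℝ} (hf : Measurable f)
    {n : ℕ} (hn : 0 < n) {κ : ℝ → ENNReal} (hκ : AEMeasurable κ) :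
    ∫⁻ x, ∑' k : ℤ, κ (n * x - k) * (n * ∫⁻ t in Set.Ioc 0 (1 / (n : ℝ)),
        ENNReal.ofReal (ψ (f (k / n + t) - f (x + t)))) ≤
      ∫⁻ y, κ (n * y) * (n * shiftModulus ψ f y) := by
  have hn' : (n : ℝ) ≠ 0 := by exact_mod_cast hn.ne'
  have hκ1 : AEMeasurable fun y : ℝ => κ (n * y) :=
    hκ.comp_quasiMeasurePreserving ⟨measurable_const_mul _, by
      rw [Real.map_volume_mul_left hn']
      exact Measure.smul_absolutelyContinuous⟩
  have hmeas (k : ℤ) : Measurable fun y : ℝ => (n : ENNReal) *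
      ∫⁻ t in Set.Ioc 0 (1 / (n : ℝ)), ENNReal.ofReal (ψ (f (k / n + t) - f (k / n + t + y))) := by
    refine Measurable.const_mul (Measurable.lintegral_prod_right'
      (f := fun p : ℝ × ℝ => ENNReal.ofReal (ψ (f (k / n + p.2) - f (k / n + p.2 + p.1)))) ?_) _
    exact hψ.measurable_ofReal.comp (by fun_prop)
  have htrans (k : ℤ) (x : ℝ) : κ (n * (x + k / n) - k) * (n * ∫⁻ t in Set.Ioc 0 (1 / (n : ℝ)),
        ENNReal.ofReal (ψ (f (k / n + t) - f (x + k / n + t)))) =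
      κ (n * x) * (n * ∫⁻ t in Set.Ioc 0 (1 / (n : ℝ)),
        ENNReal.ofReal (ψ (f (k / n + t) - f (k / n + t + x)))) := by
    congr 2
    · field_simp; ring
    · refine lintegral_congr fun t => ?_
      rw [show x + k / n + t = k / n + t + x by ring]
  have hm (k : ℤ) : AEMeasurable fun x : ℝ => κ (n * x - k) *
      (n * ∫⁻ t in Set.Ioc 0 (1 / (n : ℝ)),
        ENNReal.ofReal (ψ (f (k / n + t) - f (x + t)))) := by
    have h := (hκ1.mul (hmeas k).aemeasurable).comp_quasiMeasurePreserving
      (measurePreserving_sub_right volume ((k : ℝ) / n)).quasiMeasurePreserving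
    refine h.congr (Filter.Eventually.of_forall fun x => ?_)
    have := htrans k (x - k / n)
    rw [sub_add_cancel] at this
    exact this.symm
  rw [lintegral_tsum hm]
  calc _ = ∑' k : ℤ, ∫⁻ x, κ (n * x) * (n * ∫⁻ t in Set.Ioc 0 (1 / (n : ℝ)),
        ENNReal.ofReal (ψ (f (k / n + t) - f (k / n + t + x)))) := by
        refine tsum_congr fun k => ?_
        rw [← lintegral_add_right_eq_self _ ((k : ℝ) / n)]
        exact lintegral_congr (htrans k)
    _ = ∫⁻ x, ∑' k : ℤ, κ (n * x) * (n * ∫⁻ t in Set.Ioc 0 (1 / (n : ℝ)),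
        ENNReal.ofReal (ψ (f (k / n + t) - f (k / n + t + x)))) :=
        (lintegral_tsum fun k => hκ1.mul (hmeas k).aemeasurable).symm
    _ ≤ _ := by
        refine lintegral_mono fun y => ?_
        simp only [ENNReal.tsum_mul_left]
        rw [← hψ.lintegral_map_sub_shift]
        gcongr
        exact tsum_setLIntegral_Ioc_le (F := fun s => ENNReal.ofReal (ψ (f s - f (s + y))))
          (hψ.measurable_ofReal.comp (by fun_prop)) n

end IsEvenYoung

lemma abs_maxProdKantorovich_sub_le {χ f : ℝ → ℝ} {a C D b : ℝ} (ha : 0 < a)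
    (hχa : ∀ x ∈ Set.Icc (-(1 / 2) : ℝ) (1 / 2), a ≤ χ x) (hχC : ∀ x, |χ x| ≤ C)
    {n : ℕ} (hD : ∀ x, |steklovMean f n x| ≤ D) (hb : 0 ≤ b) (x : ℝ) :
    BddAbove (Set.range fun k : ℤ => |χ (n * x - k)| * |steklovMean f n (k / n) - b|) ∧
      a * |maxProdKantorovich χ f n x - b| ≤
        ⨆ k : ℤ, |χ (n * x - k)| * |steklovMean f n (k / n) - b| := by
  obtain ⟨hB, hle⟩ := abs_iSup_mul_sub_le (c := fun k : ℤ => χ (n * x - k))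
    (A := fun k : ℤ => steklovMean f n (k / n)) (fun k => hχC _) (fun k => hD _) hb
  refine ⟨hB, le_trans ?_ hle⟩
  have hden : a ≤ ⨆ k : ℤ, χ (n * x - k) := by
    have h1 := abs_le.1 (abs_sub_round ((n : ℝ) * x))
    refine (hχa (n * x - round ((n : ℝ) * x)) h1).trans
      (le_ciSup (f := fun k : ℤ => χ (n * x - k)) ?_ (round ((n : ℝ) * x)))
    refine ⟨C, ?_⟩
    rintro _ ⟨k, rfl⟩
    exact (le_abs_self _).trans (hχC _)
  have hpos : 0 < ⨆ k : ℤ, χ (n * x - k) := ha.trans_le hden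
  simp only [maxProdKantorovich, mul_integral_eq_steklovMean]
  rw [div_sub' hpos.ne', abs_div, abs_of_pos hpos, mul_div_assoc', div_le_iff₀ hpos, mul_comm]
  gcongr

lemma IsEvenYoung.map_maxProdKantorovich_sub_le {ψ χ f : ℝ → ℝ} (hψ : IsEvenYoung ψ) {a C : ℝ}
    (ha : 0 < a) (hχa : ∀ x ∈ Set.Icc (-(1 / 2) : ℝ) (1 / 2), a ≤ χ x) (hχC : ∀ x, |χ x| ≤ C)
    (hf : Measurable f) (hf0 : ∀ x, 0 ≤ f x) (hfin : ∫⁻ x, ENNReal.ofReal (ψ (f x)) < ⊤)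
    {n : ℕ} (hn : 0 < n) (x : ℝ) :
    ENNReal.ofReal (ψ (a / (2 * C) * (maxProdKantorovich χ f n x - f x))) ≤
      (n * ∫⁻ t in Set.Ioc 0 (1 / (n : ℝ)), ENNReal.ofReal (ψ (f (x + t) - f x))) +
      ∑' k : ℤ, ENNReal.ofReal (|χ (n * x - k)| / C) * (n * ∫⁻ t in Set.Ioc 0 (1 / (n : ℝ)),
        ENNReal.ofReal (ψ (f (k / n + t) - f (x + t)))) := by
  have haC : a ≤ C := (hχa 0 (by norm_num)).trans ((le_abs_self _).trans (hχC 0))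
  have hC : 0 < C := ha.trans_le haC
  have haC0 : 0 ≤ a / C := by positivity
  have haC1 : a / C ≤ 1 := (div_le_one hC).2 haC
  obtain ⟨D, hD⟩ := hψ.abs_steklovMean_le hf hfin hn
  set G := steklovMean f n x
  obtain ⟨hB, hle⟩ := abs_maxProdKantorovich_sub_le ha hχa hχC hD (steklovMean_nonneg hf0 n x) x
  set P := maxProdKantorovich χ f n x
  have hsplit : ψ (a / (2 * C) * (P - f x)) ≤ ψ (G - f x) + ψ (a / C * (P - G)) := by
    have h1 := hψ.map_half_add_le (a / C * (P - G)) (a / C * (G - f x))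
    rw [show 1 / 2 * (a / C * (P - G) + a / C * (G - f x)) = a / (2 * C) * (P - f x) by
      field_simp; ring] at h1
    have h2 : ψ (a / C * (G - f x)) ≤ ψ (G - f x) := hψ.mono _ _ (by
      rw [abs_mul, abs_of_nonneg haC0]
      exact mul_le_of_le_one_left (abs_nonneg _) haC1)
    have h3 := hψ.nonneg (G - f x)
    have h4 := hψ.nonneg (a / C * (P - G))
    linarith
  refine (ENNReal.ofReal_le_ofReal hsplit).trans ?_
  rw [ENNReal.ofReal_add (hψ.nonneg _) (hψ.nonneg _)]
  refine add_le_add (hψ.map_steklovMean_sub_self_le hf hfin hn x) ?_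
  have hmul := Real.mul_iSup_of_nonneg (inv_nonneg.2 hC.le)
    (fun k : ℤ => |χ (n * x - k)| * |steklovMean f n (k / n) - G|)
  have hB' : BddAbove (Set.range fun k : ℤ =>
      C⁻¹ * (|χ (n * x - k)| * |steklovMean f n (k / n) - G|)) := by
    obtain ⟨E, hE⟩ := hB
    refine ⟨C⁻¹ * E, ?_⟩
    rintro _ ⟨k, rfl⟩
    exact mul_le_mul_of_nonneg_left (hE ⟨k, rfl⟩) (inv_nonneg.2 hC.le)
  refine (hψ.ofReal_map_le_tsum hB' ?_).trans (ENNReal.tsum_le_tsum fun k => ?_)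
  · rw [← hmul, abs_mul, abs_of_nonneg haC0, div_eq_inv_mul, mul_assoc]
    gcongr
  · have h0 : 0 ≤ |χ (n * x - k)| / C := by positivity
    have h1 : ψ (C⁻¹ * (|χ (n * x - k)| * |steklovMean f n (k / n) - G|)) ≤
        |χ (n * x - k)| / C * ψ (steklovMean f n (k / n) - G) := by
      rw [← mul_assoc, ← div_eq_inv_mul]
      refine (hψ.map_mul_le h0 ((div_le_one hC).2 (hχC _)) _).trans ?_
      gcongr
      exact hψ.mono _ _ (by simp)
    refine (ENNReal.ofReal_le_ofReal h1).trans ?_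
    rw [ENNReal.ofReal_mul h0]
    gcongr
    exact hψ.map_steklovMean_sub_le hf hfin hn _ _

lemma IsEvenYoung.shiftModulus_le {ψ f : ℝ → ℝ} (hψ : IsEvenYoung ψ) (hf : Measurable f)
    (hf0 : ∀ x, 0 ≤ f x) (h : ℝ) :
    shiftModulus ψ f h ≤ 2 * ∫⁻ x, ENNReal.ofReal (ψ (f x)) := by
  have hle (x : ℝ) : ENNReal.ofReal (ψ (f (x + h) - f x)) ≤
      ENNReal.ofReal (ψ (f x)) + ENNReal.ofReal (ψ (f (x + h))) := by
    have h1 := hf0 x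
    have h2 := hf0 (x + h)
    rcases le_total (f x) (f (x + h)) with hx | hx
    · refine le_add_left (ENNReal.ofReal_le_ofReal (hψ.mono _ _ ?_))
      rw [abs_of_nonneg (by linarith), abs_of_nonneg h2]
      linarith
    · refine le_add_right (ENNReal.ofReal_le_ofReal (hψ.mono _ _ ?_))
      rw [abs_of_nonpos (by linarith), abs_of_nonneg h1]
      linarith
  refine (lintegral_mono hle).trans_eq ?_
  rw [lintegral_add_left (by exact hψ.measurable_ofReal.comp hf),
    lintegral_add_right_eq_self (fun x => ENNReal.ofReal (ψ (f x))) h, two_mul]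

lemma lintegral_kernel_mul_le {χ : ℝ → ℝ} (hχ : Integrable χ) {C : ℝ} (hC : 0 < C) {n : ℕ}
    (hn : 0 < n) {S : Set ℝ} (hS : MeasurableSet S) {ω : ℝ → ENNReal} {E₁ E₂ : ℝ} (hE₁ : 0 ≤ E₁)
    (hE₂ : 0 ≤ E₂) (h₁ : ∀ y ∉ S, ω y ≤ ENNReal.ofReal E₁) (h₂ : ∀ y, ω y ≤ ENNReal.ofReal E₂) :
    ∫⁻ y, ENNReal.ofReal (|χ (n * y)| / C) * (n * ω y) ≤
      ENNReal.ofReal ((n * ∫ y in S, |χ (n * y)|) * (E₂ / C)) +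
        ENNReal.ofReal ((∫ y, |χ y|) * (E₁ / C)) := by
  have hn' : (0 : ℝ) < n := by exact_mod_cast hn
  have hint : Integrable fun y : ℝ => |χ (n * y)| := (hχ.comp_mul_left' hn'.ne').abs
  have key {T : Set ℝ} (hT : MeasurableSet T) {E : ℝ} (hE : 0 ≤ E)
      (hω : ∀ y ∈ T, ω y ≤ ENNReal.ofReal E) :
      ∫⁻ y in T, ENNReal.ofReal (|χ (n * y)| / C) * (n * ω y) ≤
        ENNReal.ofReal ((n * ∫ y in T, |χ (n * y)|) * (E / C)) := by
    have hEC : 0 ≤ n * (E / C) := by positivity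
    rw [show (n * ∫ y in T, |χ (n * y)|) * (E / C) = ∫ y in T, |χ (n * y)| * (n * (E / C)) by
        rw [integral_mul_const]; ring,
      ofReal_integral_eq_lintegral_ofReal (hint.mul_const _).integrableOn
        (Filter.Eventually.of_forall fun y => mul_nonneg (abs_nonneg _) hEC)]
    refine setLIntegral_mono' hT fun y hy => ?_
    calc _ ≤ ENNReal.ofReal (|χ (n * y)| / C) * (ENNReal.ofReal n * ENNReal.ofReal E) := by
          rw [ENNReal.ofReal_natCast]
          gcongr
          exact hω y hy
      _ = _ := by
          rw [← ENNReal.ofReal_mul hn'.le, ← ENNReal.ofReal_mul (by positivity)]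
          congr 1
          ring
  rw [← lintegral_add_compl _ hS]
  refine add_le_add (key hS hE₂ fun y _ => h₂ y) ((key hS.compl hE₁ h₁).trans ?_)
  gcongr
  calc (n : ℝ) * ∫ y in Sᶜ, |χ (n * y)| ≤ n * ∫ y : ℝ, |χ (n * y)| := by
        gcongr ?_ * ?_
        exact setIntegral_le_integral hint (Filter.Eventually.of_forall fun _ => abs_nonneg _)
    _ = ∫ y, |χ y| := by
        rw [Measure.integral_comp_mul_left (fun y => |χ y|), abs_of_pos (inv_pos.2 hn'),
          smul_eq_mul, mul_inv_cancel_left₀ hn'.ne']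

/-- (Qualitative order of approximation on Lipschitz classes.) Let `φ`
be a convex φ-function and `χ` a generalized kernel satisfying `(χ4)` for a fixed
`0 < α < 1` with constants `M, γ > 0`. Then for any nonnegative `f ∈ Lip_φ(v)` with
`0 < v ≤ 1`, there exist `K > 0` and `λ > 0` such that
`I^φ[λ(K_n^χ f − f)] ≤ K·n^{−ρ}` for `n ∈ ℕ` sufficiently large, where
`ρ := min {α v, γ}`. -/
theorem max_product_kantorovich_lipschitz_order
    (φ : ℝ → ℝ)
    (hφmono : MonotoneOn φ (Set.Ici 0)) (hφcont : ContinuousOn φ (Set.Ici 0))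
    (hφ0 : φ 0 = 0) (hφpos : ∀ u : ℝ, 0 < u → 0 < φ u)
    (hφtop : Filter.Tendsto φ Filter.atTop Filter.atTop)
    (hφconv : ConvexOn ℝ (Set.Ici 0) φ)
    (χ : ℝ → ℝ)
    -- (χ1): `χ ∈ L¹(ℝ)` and `χ` is bounded on `ℝ`
    (hχ1 : Integrable χ) (hχb : ∃ C : ℝ, ∀ x : ℝ, |χ x| ≤ C)
    -- (χ2): `aχ := inf_{x ∈ [-1/2,1/2]} χ x > 0`
    (aχ : ℝ) (haχ : 0 < aχ) (hinf : sInf (χ '' Set.Icc (-(1/2) : ℝ) (1/2)) = aχ)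
    -- (χ3): the generalized absolute moment of some order `β > 0` is finite
    (β : ℝ) (hβ : 0 < β)
    (hmβ : BddAbove
      (Set.range fun p : ℝ × ℤ => |χ (p.1 - p.2)| * |p.1 - (p.2 : ℝ)| ^ β))
    -- (χ4): for the fixed `0 < α < 1` and constants `M, γ > 0`
    (α : ℝ) (hα0 : 0 < α) (hα1 : α < 1)
    (M γ : ℝ) (hM : 0 < M) (hγ : 0 < γ)
    (hχ4 : ∃ N : ℕ, ∀ n : ℕ, N ≤ n →
      (n : ℝ) * ∫ y in {y : ℝ | 1 / (n : ℝ) ^ α < |y|}, |χ ((n : ℝ) * y)| ≤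
        M * (n : ℝ) ^ (-γ))
    -- `f` nonnegative, `f ∈ Lip_φ(v)` with `0 < v ≤ 1`
    (v : ℝ) (hv0 : 0 < v) (hv1 : v ≤ 1)
    (f : ℝ → ℝ) (hfmeas : Measurable f) (hfnn : ∀ x : ℝ, 0 ≤ f x)
    (hfφ : ∃ c : ℝ, 0 < c ∧ modular φ (fun x => c * f x) < ⊤)
    (hLip : ∃ μ : ℝ, 0 < μ ∧ ∃ C : ℝ, 0 < C ∧ ∃ δ : ℝ, 0 < δ ∧ ∀ h : ℝ, |h| ≤ δ →
      modular φ (fun x => μ * (f (x + h) - f x)) ≤ ENNReal.ofReal (C * |h| ^ v)) :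
    ∃ K : ℝ, 0 < K ∧ ∃ lam : ℝ, 0 < lam ∧ ∃ N : ℕ, ∀ n : ℕ, N ≤ n →
      modular φ (fun x => lam * (maxProdKantorovich χ f n x - f x)) ≤
        ENNReal.ofReal (K * (n : ℝ) ^ (-(min (α * v) γ))) := by
  obtain ⟨C, hχC⟩ := hχb
  obtain ⟨c, hc, hcfin⟩ := hfφ
  obtain ⟨μ, hμ, L, hL, δ, hδ, hlip⟩ := hLip
  obtain ⟨N₀, hN₀⟩ := hχ4
  have hχa : ∀ x ∈ Set.Icc (-(1 / 2) : ℝ) (1 / 2), aχ ≤ χ x := fun x hx => by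
    rw [← hinf]
    refine csInf_le ⟨-C, ?_⟩ ⟨x, hx, rfl⟩
    rintro _ ⟨y, -, rfl⟩
    exact (abs_le.1 (hχC y)).1
  have hC : 0 < C :=
    haχ.trans_le ((hχa 0 (by norm_num)).trans ((le_abs_self _).trans (hχC 0)))
  set l := min μ c
  have hl0 : 0 < l := lt_min hμ hc
  set ψ : ℝ → ℝ := fun u => φ |l * u| with hψdef
  have hψ : IsEvenYoung ψ := .of_abs hφmono hφcont hφ0 hφpos hφconv hl0
  have hscale {s : ℝ} (hs : l ≤ s) (u : ℝ) : ψ u ≤ φ |s * u| := by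
    refine hφmono (Set.mem_Ici.2 (abs_nonneg _)) (Set.mem_Ici.2 (abs_nonneg _)) ?_
    rw [abs_mul, abs_mul]
    gcongr
  have hfin : ∫⁻ x, ENNReal.ofReal (ψ (f x)) < ⊤ := lt_of_le_of_lt
    (lintegral_mono fun x => ENNReal.ofReal_le_ofReal (hscale (min_le_right _ _) _)) hcfin
  set B := (2 * ∫⁻ x, ENNReal.ofReal (ψ (f x))).toReal
  have hB (h : ℝ) : shiftModulus ψ f h ≤ ENNReal.ofReal B := by
    rw [ENNReal.ofReal_toReal (ENNReal.mul_ne_top (by simp) hfin.ne)]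
    exact hψ.shiftModulus_le hfmeas hfnn h
  have hω {h : ℝ} (hh : |h| ≤ δ) : shiftModulus ψ f h ≤ ENNReal.ofReal (L * |h| ^ v) := le_trans
    (lintegral_mono fun x => ENNReal.ofReal_le_ofReal (hscale (min_le_left _ _) _)) (hlip h hh)
  have hB0 : 0 ≤ B := ENNReal.toReal_nonneg
  have hI0 : 0 ≤ ∫ y, |χ y| := integral_nonneg fun _ => abs_nonneg _
  refine ⟨L + M * (B / C) + (∫ y, |χ y|) * (L / C), by positivity, l * (aχ / (2 * C)),
    by positivity, ?_⟩
  have hev : ∀ᶠ n : ℕ in Filter.atTop, (n : ℝ) ^ (-α) ≤ δ :=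
    (((tendsto_rpow_neg_atTop hα0).comp tendsto_natCast_atTop_atTop).eventually_lt_const
      hδ).mono fun _ h => h.le
  obtain ⟨N₁, hN₁⟩ := Filter.eventually_atTop.1 hev
  refine ⟨max (max N₀ N₁) 1, fun n hn => ?_⟩
  have hn0 : N₀ ≤ n := (le_max_left _ _).trans ((le_max_left _ _).trans hn)
  have hnδ := hN₁ n ((le_max_right _ _).trans ((le_max_left _ _).trans hn))
  have hn1 : 1 ≤ n := (le_max_right _ _).trans hn
  have hn1' : (1 : ℝ) ≤ n := by exact_mod_cast hn1
  have hnpos : (0 : ℝ) < n := by linarith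
  have hnear {h : ℝ} (hh : |h| ≤ (n : ℝ) ^ (-α)) :
      shiftModulus ψ f h ≤ ENNReal.ofReal (L * (n : ℝ) ^ (-(α * v))) := by
    refine (hω (hh.trans hnδ)).trans (ENNReal.ofReal_le_ofReal ?_)
    rw [← neg_mul, Real.rpow_mul hnpos.le]
    gcongr
  have hstep {h : ℝ} (hh : h ∈ Set.Ioc 0 (1 / (n : ℝ))) : |h| ≤ (n : ℝ) ^ (-α) := by
    rw [abs_of_pos hh.1]
    refine hh.2.trans ?_
    rw [one_div, ← Real.rpow_neg_one]
    exact Real.rpow_le_rpow_of_exponent_le hn1' (by linarith)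
  set S : Set ℝ := {y : ℝ | 1 / (n : ℝ) ^ α < |y|}
  have hS : MeasurableSet S := measurableSet_lt measurable_const measurable_id.abs
  have hout : ∀ y ∉ S, shiftModulus ψ f y ≤ ENNReal.ofReal (L * (n : ℝ) ^ (-(α * v))) := by
    refine fun y hy => hnear ?_
    rw [Real.rpow_neg hnpos.le, ← one_div]
    exact not_lt.1 hy
  set r := (n : ℝ) ^ (-(min (α * v) γ))
  have hr1 : (n : ℝ) ^ (-(α * v)) ≤ r :=
    Real.rpow_le_rpow_of_exponent_le hn1' (neg_le_neg (min_le_left _ _))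
  have hr2 : (n : ℝ) ^ (-γ) ≤ r :=
    Real.rpow_le_rpow_of_exponent_le hn1' (neg_le_neg (min_le_right _ _))
  have hr0 : 0 ≤ r := by positivity
  calc modular φ (fun x => l * (aχ / (2 * C)) * (maxProdKantorovich χ f n x - f x))
      = ∫⁻ x, ENNReal.ofReal (ψ (aχ / (2 * C) * (maxProdKantorovich χ f n x - f x))) := by
        simp only [modular, hψdef, mul_assoc]
    _ ≤ _ := lintegral_mono fun x =>
        hψ.map_maxProdKantorovich_sub_le haχ hχa hχC hfmeas hfnn hfin hn1 x
    _ ≤ ENNReal.ofReal (L * (n : ℝ) ^ (-(α * v))) +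
        (ENNReal.ofReal ((n * ∫ y in S, |χ (n * y)|) * (B / C)) +
          ENNReal.ofReal ((∫ y, |χ y|) * (L * (n : ℝ) ^ (-(α * v)) / C))) := by
        rw [lintegral_add_left (by exact
          (hψ.measurable_uncurry_shift hfmeas).lintegral_prod_right'.const_mul _)]
        refine add_le_add (hψ.lintegral_mean_shift_le hfmeas hn1 fun h hh => hnear (hstep hh)) ?_
        refine (hψ.lintegral_tsum_kernel_le hfmeas hn1
          (κ := fun u => ENNReal.ofReal (|χ u| / C))
          (hχ1.aestronglyMeasurable.aemeasurable.abs.div_const C).ennreal_ofReal).trans ?_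
        exact lintegral_kernel_mul_le hχ1 hC hn1 hS (by positivity) hB0 hout hB
    _ ≤ ENNReal.ofReal (L * r) + (ENNReal.ofReal (M * r * (B / C)) +
          ENNReal.ofReal ((∫ y, |χ y|) * (L * r / C))) := by
        have hMr : n * ∫ y in S, |χ (n * y)| ≤ M * r := (hN₀ n hn0).trans (by gcongr)
        gcongr ENNReal.ofReal (_ * ?_) + (ENNReal.ofReal (?_ * _) +
          ENNReal.ofReal (_ * (_ * ?_ / _)))
    _ = ENNReal.ofReal ((L + M * (B / C) + (∫ y, |χ y|) * (L / C)) * r) := by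
        rw [← ENNReal.ofReal_add (by positivity) (by positivity),
          ← ENNReal.ofReal_add (by positivity) (by positivity)]
        congr 1
        ring
end

section
/- Let χ: ℝ → ℝ be a function such that χ(x) = O(|x|^{−θ}) as |x| → +∞ for some θ > 1. Then for every fixed 0 < α < 1 there exists a constant M > 0 such that n ∫_{|y| > 1/n^α} |χ(ny)| dy ≤ M·n^{−γ} for all n ∈ ℕ sufficiently large, with γ = (1−α)(θ−1) > 0; i.e., condition (χ4) is satisfied. -/
open MeasureTheory

theorem setIntegral_lt_abs_comp_abs (f : ℝ → ℝ) {d : ℝ} (hd : 0 ≤ d) :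
    ∫ y in {y : ℝ | d < |y|}, f |y| = 2 * ∫ y in Set.Ioi d, f y := by
  have hm : MeasurableSet {y : ℝ | d < |y|} := measurableSet_lt measurable_const measurable_id.abs
  have h := integral_comp_abs (f := (Set.Ioi d).indicator f)
  rw [setIntegral_indicator measurableSet_Ioi, Set.Ioi_inter_Ioi, max_eq_right hd] at h
  rw [← h, ← integral_indicator hm]
  rfl

theorem setIntegral_lt_abs_rpow {θ d : ℝ} (hθ : 1 < θ) (hd : 0 < d) :
    ∫ y in {y : ℝ | d < |y|}, |y| ^ (-θ) = 2 / (θ - 1) * d ^ (1 - θ) := by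
  rw [setIntegral_lt_abs_comp_abs (fun y => y ^ (-θ)) hd.le,
    integral_Ioi_rpow_of_lt (by linarith) hd, neg_add_eq_sub, ← neg_sub θ 1, neg_div_neg_eq]
  ring

theorem integrableOn_lt_abs_rpow {θ d : ℝ} (hθ : 1 < θ) (hd : 0 < d) :
    IntegrableOn (fun y : ℝ => |y| ^ (-θ)) {y : ℝ | d < |y|} := by
  by_contra h
  have hpos : 0 < 2 / (θ - 1) * d ^ (1 - θ) :=
    mul_pos (div_pos two_pos (sub_pos.2 hθ)) (Real.rpow_pos_of_pos hd _)
  rw [← setIntegral_lt_abs_rpow hθ hd, integral_undef h] at hpos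
  exact hpos.false

theorem setIntegral_abs_comp_mul_le {χ : ℝ → ℝ} {θ C R a d : ℝ} (hθ : 1 < θ)
    (hχ : ∀ x : ℝ, R ≤ |x| → |χ x| ≤ C * |x| ^ (-θ)) (ha : 0 < a) (hd : 0 < d)
    (hR : R ≤ a * d) :
    ∫ y in {y : ℝ | d < |y|}, |χ (a * y)| ≤
      C * a ^ (-θ) * (2 / (θ - 1) * d ^ (1 - θ)) := by
  have hm : MeasurableSet {y : ℝ | d < |y|} := measurableSet_lt measurable_const measurable_id.abs
  rw [← setIntegral_lt_abs_rpow hθ hd, ← integral_const_mul]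
  refine integral_mono_of_nonneg (ae_of_all _ fun y => abs_nonneg _)
    ((integrableOn_lt_abs_rpow hθ hd).const_mul _) ?_
  filter_upwards [ae_restrict_mem hm] with y hy
  have habs : |a * y| = a * |y| := by rw [abs_mul, abs_of_pos ha]
  have hle : a * d ≤ a * |y| := mul_le_mul_of_nonneg_left (le_of_lt hy) ha.le
  have h := hχ (a * y) (habs ▸ hR.trans hle)
  rwa [habs, Real.mul_rpow ha.le (abs_nonneg y), ← mul_assoc] at h

/-- Let `χ : ℝ → ℝ` satisfy `χ(x) = O(|x|^{−θ})` as `|x| → ∞` for some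
`θ > 1`. Then for every fixed `0 < α < 1` there exists `M > 0` such that
`n ∫_{|y| > 1/n^α} |χ(ny)| dy ≤ M·n^{−γ}` for all `n ∈ ℕ` sufficiently large, with
`γ = (1−α)(θ−1) > 0`; i.e. condition `(χ4)` holds. -/
theorem decay_kernel_satisfies_chi4
    (χ : ℝ → ℝ) (θ : ℝ) (hθ : 1 < θ)
    (hO : ∃ C : ℝ, 0 < C ∧ ∃ R : ℝ, 0 < R ∧ ∀ x : ℝ, R ≤ |x| → |χ x| ≤ C * |x| ^ (-θ)) :
    ∀ α : ℝ, 0 < α → α < 1 →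
      0 < (1 - α) * (θ - 1) ∧
      ∃ M : ℝ, 0 < M ∧ ∃ N : ℕ, ∀ n : ℕ, N ≤ n →
        (n : ℝ) * ∫ y in {y : ℝ | 1 / (n : ℝ) ^ α < |y|}, |χ ((n : ℝ) * y)| ≤
          M * (n : ℝ) ^ (-((1 - α) * (θ - 1))) := by
  obtain ⟨C, hC, R, hR, hχ⟩ := hO
  intro α hα hα1
  refine ⟨mul_pos (sub_pos.2 hα1) (sub_pos.2 hθ), 2 * C / (θ - 1),
    div_pos (mul_pos two_pos hC) (sub_pos.2 hθ), ?_⟩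
  have hlim : Filter.Tendsto (fun n : ℕ => (n : ℝ) ^ (1 - α)) Filter.atTop Filter.atTop :=
    (tendsto_rpow_atTop (sub_pos.2 hα1)).comp tendsto_natCast_atTop_atTop
  obtain ⟨N, hN⟩ := Filter.eventually_atTop.1
    ((hlim.eventually_ge_atTop R).and (Filter.eventually_gt_atTop 0))
  refine ⟨N, fun n hn => ?_⟩
  obtain ⟨hnR, hn0⟩ := hN n hn
  have hn' : (0 : ℝ) < n := Nat.cast_pos.2 hn0
  have hd : 1 / (n : ℝ) ^ α = (n : ℝ) ^ (-α) := by rw [Real.rpow_neg hn'.le, one_div]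
  have hnd : (n : ℝ) * (n : ℝ) ^ (-α) = (n : ℝ) ^ (1 - α) := by
    rw [sub_eq_add_neg, Real.rpow_add hn', Real.rpow_one]
  have hpow : (n : ℝ) * ((n : ℝ) ^ (-θ) * ((n : ℝ) ^ (-α)) ^ (1 - θ)) =
      (n : ℝ) ^ (-((1 - α) * (θ - 1))) := by
    rw [← Real.rpow_mul hn'.le, ← Real.rpow_add hn', ← Real.rpow_one_add' hn'.le]
    · congr 1
      ring
    · nlinarith [mul_pos (sub_pos.2 hα1) (sub_pos.2 hθ)]
  rw [hd]
  calc (n : ℝ) * ∫ y in {y : ℝ | (n : ℝ) ^ (-α) < |y|}, |χ ((n : ℝ) * y)|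
      ≤ n * (C * (n : ℝ) ^ (-θ) * (2 / (θ - 1) * ((n : ℝ) ^ (-α)) ^ (1 - θ))) :=
        mul_le_mul_of_nonneg_left (setIntegral_abs_comp_mul_le hθ hχ hn'
          (Real.rpow_pos_of_pos hn' _) (hnd ▸ hnR)) hn'.le
    _ = 2 * C / (θ - 1) * ((n : ℝ) * ((n : ℝ) ^ (-θ) * ((n : ℝ) ^ (-α)) ^ (1 - θ))) := by
        ring
    _ = _ := by rw [hpow]
end
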